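/- arXiv:1205.5309 — 4 statements merged into one kernel-verified Lean document; each statement's English description precedes it below -/
import Mathlib

section
/- Suppose the function b ↦ ρ(0, b, 0) has a zero of order exactly k at b = 0, i.e., ρ(0, b, 0) = c b^k + O(b^{k+1}) with c ≠ 0. Then there exist neighborhoods U and W of 0 in ℂⁿ and a dense subset D ⊆ W such that for every q ∈ D the set F⁻¹(q) ∩ U consists of exactly k distinct points. (This is the multiplicity statement of Proposition 3.1: mult₀(F) = k.) -/
open Complex Filter Topology Asymptotics

lemma aux_finite_zeros {f : ℂ → ℂ} {R' ε : ℝ} (hε : ε < R')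
    (hf : DifferentiableOn ℂ f (Metric.ball 0 R'))
    (hne : ∃ z ∈ Metric.ball (0:ℂ) R', f z ≠ 0) :
    {z | z ∈ Metric.closedBall (0:ℂ) ε ∧ f z = 0}.Finite := by
  by_contra hinf
  obtain ⟨z, hz, hacc⟩ := Set.Infinite.exists_accPt_of_subset_isCompact hinf
    (isCompact_closedBall (0:ℂ) ε) (fun z hz => hz.1)
  rw [accPt_iff_frequently_nhdsNE] at hacc
  have h0 := (hf.analyticOnNhd Metric.isOpen_ball).eqOn_zero_of_preconnected_of_frequently_eq_zero
    (convex_ball _ _).isPreconnected (Metric.closedBall_subset_ball hε hz)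
    (hacc.mono fun z hz => hz.2)
  obtain ⟨w, hw, hw'⟩ := hne
  exact hw' (h0 hw)

lemma aux_count {R' ε : ℝ} (hε0 : 0 < ε) (hε : ε < R') (s : Finset ℂ) : ∀ {f : ℂ → ℂ}
    (_ : DifferentiableOn ℂ f (Metric.ball 0 R'))
    (_ : ∀ z, z ∈ s ↔ z ∈ Metric.closedBall (0:ℂ) ε ∧ f z = 0)
    (_ : ∀ z ∈ Metric.sphere (0:ℂ) ε, f z ≠ 0)
    (_ : ∀ z ∈ s, deriv f z ≠ 0),
    (∮ z in C(0, ε), logDeriv f z) = 2 * Real.pi * I * s.card := by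
  have hsub : Metric.closedBall (0:ℂ) ε ⊆ Metric.ball 0 R' := Metric.closedBall_subset_ball hε
  induction s using Finset.induction_on with
  | empty =>
    intro f hf hs hsp hd
    have h1 : DifferentiableOn ℂ (logDeriv f) (Metric.closedBall 0 ε) := by
      have : DifferentiableOn ℂ (deriv f) (Metric.ball 0 R') := hf.deriv Metric.isOpen_ball
      refine (this.mono hsub).div (hf.mono hsub) fun z hz h => ?_
      exact absurd ((hs z).2 ⟨hz, h⟩) (by simp)
    simp only [Finset.card_empty, Nat.cast_zero, mul_zero]
    refine circleIntegral_eq_zero_of_differentiable_on_off_countable hε0.le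
      Set.countable_empty h1.continuousOn fun z hz => ?_
    exact h1.differentiableAt (Metric.closedBall_mem_nhds_of_mem hz.1)
  | insert z0 s hz0 ih =>
    intro f hf hs hsp hd
    obtain ⟨hz0b, hfz0⟩ := (hs z0).1 (Finset.mem_insert_self _ _)
    have hz0B : z0 ∈ Metric.ball (0:ℂ) ε := by
      rcases (Metric.mem_closedBall.1 hz0b).lt_or_eq with h | h
      · exact h
      · exact absurd hfz0 (hsp z0 h)
    have hnh : Metric.ball (0:ℂ) R' ∈ 𝓝 z0 := Metric.isOpen_ball.mem_nhds (hsub hz0b)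
    set g := dslope f z0 with hg
    have hgd : DifferentiableOn ℂ g (Metric.ball 0 R') :=
      (Complex.differentiableOn_dslope hnh).2 hf
    have hfg : ∀ z, f z = (z - z0) * g z := by
      intro z
      have := sub_smul_dslope f z0 z
      rw [hfz0, sub_zero, smul_eq_mul] at this
      exact this.symm
    have hfg' : f = fun z => (z - z0) * g z := funext hfg
    have hgz0 : g z0 ≠ 0 := by
      rw [hg, dslope_same]; exact hd z0 (Finset.mem_insert_self _ _)
    have hgat : ∀ z ∈ Metric.closedBall (0:ℂ) ε, DifferentiableAt ℂ g z := fun z hz =>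
      hgd.differentiableAt (Metric.isOpen_ball.mem_nhds (hsub hz))
    have hgs : ∀ z ∈ Metric.sphere (0:ℂ) ε, g z ≠ 0 := fun z hz h =>
      hsp z hz (by rw [hfg, h, mul_zero])
    have key := ih hgd (fun z => by
      constructor
      · intro hz
        have h1 := (hs z).1 (Finset.mem_insert_of_mem hz)
        refine ⟨h1.1, ?_⟩
        have h2 := h1.2
        rw [hfg] at h2
        rcases mul_eq_zero.1 h2 with h | h
        · exact absurd (sub_eq_zero.1 h ▸ hz) hz0
        · exact h
      · rintro ⟨h1, h2⟩
        have h3 := (hs z).2 ⟨h1, by rw [hfg, h2, mul_zero]⟩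
        rcases Finset.mem_insert.1 h3 with h | h
        · exact absurd (h ▸ h2) hgz0
        · exact h) hgs (fun z hz => by
        have h1 := (hs z).1 (Finset.mem_insert_of_mem hz)
        have h2 := hd z (Finset.mem_insert_of_mem hz)
        have hzz : z - z0 ≠ 0 := fun h => hz0 (sub_eq_zero.1 h ▸ hz)
        have hgz : g z = 0 := by
          have := h1.2
          rw [hfg] at this
          exact (mul_eq_zero.1 this).resolve_left hzz
        have h3 : HasDerivAt f (1 * g z + (z - z0) * deriv g z) z := by
          rw [hfg']
          exact ((hasDerivAt_id z).sub_const z0).mul (hgat z h1.1).hasDerivAt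
        rw [h3.deriv, hgz] at h2
        intro h; rw [h] at h2; simp at h2)
    have hcont : ContinuousOn (logDeriv g) (Metric.sphere 0 ε) := by
      have h1 : ContinuousOn (deriv g) (Metric.ball 0 R') :=
        (hgd.deriv Metric.isOpen_ball).continuousOn
      have h2 := Metric.sphere_subset_closedBall.trans hsub
      exact (h1.mono h2).div (hgd.continuousOn.mono h2) hgs
    have hnz : ∀ z ∈ Metric.sphere (0:ℂ) ε, z - z0 ≠ 0 := fun z hz h => by
      rw [sub_eq_zero] at h
      subst h
      rw [mem_sphere_iff_norm] at hz; rw [mem_ball_iff_norm] at hz0B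
      linarith
    have hcont2 : ContinuousOn (fun z : ℂ => (z - z0)⁻¹) (Metric.sphere 0 ε) :=
      (by fun_prop : ContinuousOn (fun z : ℂ => z - z0) _).inv₀ hnz
    have heq : ∀ z ∈ Metric.sphere (0:ℂ) ε, logDeriv f z = (z - z0)⁻¹ + logDeriv g z := by
      intro z hz
      rw [hfg', logDeriv_mul (f := fun z => z - z0) z (hnz z hz) (hgs z hz) (by fun_prop)
        (hgat z (Metric.sphere_subset_closedBall hz))]
      congr 1
      simp [logDeriv_apply]
    rw [circleIntegral.integral_congr hε0.le heq,
      circleIntegral.integral_add (hcont2.circleIntegrable hε0.le) (hcont.circleIntegrable hε0.le),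
      key, circleIntegral.integral_sub_inv_of_mem_ball hz0B, Finset.card_insert_of_notMem hz0]
    push_cast; ring

lemma aux_rouche {R' ε : ℝ} (hε0 : 0 < ε) (hε : ε < R') {f : ℂ → ℂ} {k : ℕ} {c : ℂ} (hc : c ≠ 0)
    (hf : DifferentiableOn ℂ f (Metric.ball 0 R'))
    (hcl : ∀ z ∈ Metric.sphere (0:ℂ) ε, ‖f z - c * z ^ k‖ < ‖c * z ^ k‖) :
    (∮ z in C(0, ε), logDeriv f z) = 2 * Real.pi * I * k := by
  have hsub : Metric.sphere (0:ℂ) ε ⊆ Metric.ball 0 R' :=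
    Metric.sphere_subset_closedBall.trans (Metric.closedBall_subset_ball hε)
  have hz0 : ∀ z ∈ Metric.sphere (0:ℂ) ε, z ≠ 0 := fun z hz h => by
    simp [h] at hz; linarith
  have hp0 : ∀ z ∈ Metric.sphere (0:ℂ) ε, c * z ^ k ≠ 0 := fun z hz =>
    mul_ne_zero hc (pow_ne_zero _ (hz0 z hz))
  have hf0 : ∀ z ∈ Metric.sphere (0:ℂ) ε, f z ≠ 0 := fun z hz h => by
    have := hcl z hz
    rw [h, zero_sub, norm_neg] at this
    exact lt_irrefl _ this
  have hfat : ∀ z ∈ Metric.sphere (0:ℂ) ε, DifferentiableAt ℂ f z := fun z hz =>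
    hf.differentiableAt (Metric.isOpen_ball.mem_nhds (hsub hz))
  set v : ℂ → ℂ := fun z => f z / (c * z ^ k) with hv
  have hvd : ∀ z ∈ Metric.sphere (0:ℂ) ε, DifferentiableAt ℂ v z := fun z hz =>
    (hfat z hz).div (by fun_prop) (hp0 z hz)
  have hslit : ∀ z ∈ Metric.sphere (0:ℂ) ε, v z ∈ slitPlane := fun z hz => by
    apply ball_one_subset_slitPlane
    rw [mem_ball_iff_norm]
    have : v z - 1 = (f z - c * z ^ k) / (c * z ^ k) := by
      rw [sub_div, div_self (hp0 z hz)]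
    rw [this, norm_div, div_lt_one (norm_pos_iff.2 (hp0 z hz))]
    exact hcl z hz
  have hint0 : (∮ z in C(0, ε), deriv v z / v z) = 0 :=
    circleIntegral.integral_eq_zero_of_hasDerivWithinAt (f := fun z => log (v z)) hε0.le
      fun z hz => ((hvd z hz).hasDerivAt.clog (hslit z hz)).hasDerivWithinAt
  have hcontF : ContinuousOn (logDeriv f) (Metric.sphere 0 ε) :=
    (((hf.deriv Metric.isOpen_ball).continuousOn).mono hsub).div (hf.continuousOn.mono hsub) hf0
  have hcont2 : ContinuousOn (fun z : ℂ => (k:ℂ) * (z - 0)⁻¹) (Metric.sphere 0 ε) :=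
    continuousOn_const.mul ((by fun_prop : ContinuousOn (fun z : ℂ => z - 0) _).inv₀
      (fun z hz => by simpa using hz0 z hz))
  have heq : ∀ z ∈ Metric.sphere (0:ℂ) ε,
      deriv v z / v z = logDeriv f z - (k:ℂ) * (z - 0)⁻¹ := by
    intro z hz
    change logDeriv v z = _
    rw [hv, logDeriv_div (g := fun z => c * z ^ k) z (hf0 z hz) (hp0 z hz) (hfat z hz)
      (by fun_prop), logDeriv_const_mul (f := fun z => z ^ k) z c hc, logDeriv_pow]
    simp [div_eq_mul_inv]
  rw [circleIntegral.integral_congr hε0.le heq,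
    circleIntegral.integral_sub (hcontF.circleIntegrable hε0.le) (hcont2.circleIntegrable hε0.le),
    sub_eq_zero, circleIntegral.integral_const_mul,
    circleIntegral.integral_sub_inv_of_mem_ball (by simpa using hε0)] at hint0
  rw [hint0]; ring

lemma aux_main1 {R' ε : ℝ} (hε0 : 0 < ε) (hε : ε < R') {f : ℂ → ℂ} {k : ℕ} {c : ℂ} (hc : c ≠ 0)
    (hf : DifferentiableOn ℂ f (Metric.ball 0 R'))
    (hcl : ∀ z ∈ Metric.sphere (0:ℂ) ε, ‖f z - c * z ^ k‖ < ‖c * z ^ k‖)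
    (hd : ∀ z ∈ Metric.closedBall (0:ℂ) ε, f z = 0 → deriv f z ≠ 0) :
    ∃ s : Finset ℂ, s.card = k ∧ ∀ z, z ∈ s ↔ z ∈ Metric.ball (0:ℂ) ε ∧ f z = 0 := by
  have hf0 : ∀ z ∈ Metric.sphere (0:ℂ) ε, f z ≠ 0 := fun z hz h => by
    have := hcl z hz
    rw [h, zero_sub, norm_neg] at this
    exact lt_irrefl _ this
  have hmem : (ε:ℂ) ∈ Metric.sphere (0:ℂ) ε := by simp [abs_of_pos hε0]
  have hfin := aux_finite_zeros hε hf ⟨ε, Metric.closedBall_subset_ball hε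
    (Metric.sphere_subset_closedBall hmem), hf0 _ hmem⟩
  have hs : ∀ z, z ∈ hfin.toFinset ↔ z ∈ Metric.closedBall (0:ℂ) ε ∧ f z = 0 := fun z => by simp
  refine ⟨hfin.toFinset, ?_, ?_⟩
  · have h1 := aux_count hε0 hε hfin.toFinset hf hs hf0
      (fun z hz => hd z ((hs z).1 hz).1 ((hs z).1 hz).2)
    rw [aux_rouche hε0 hε hc hf hcl] at h1
    have h2 := mul_left_cancel₀ two_pi_I_ne_zero h1
    exact_mod_cast h2.symm
  · intro z
    rw [hs]
    constructor
    · rintro ⟨h1, h2⟩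
      refine ⟨?_, h2⟩
      rcases (Metric.mem_closedBall.1 h1).lt_or_eq with h | h
      · exact h
      · exact absurd h2 (hf0 z h)
    · rintro ⟨h1, h2⟩
      exact ⟨Metric.ball_subset_closedBall h1, h2⟩

lemma aux_crit {R' ε : ℝ} (hε0 : 0 < ε) (hε : ε < R') {f : ℂ → ℂ} {k : ℕ} (hk : 1 ≤ k) {c : ℂ}
    (hf : DifferentiableOn ℂ f (Metric.ball 0 R'))
    (hcl : ∀ z ∈ Metric.sphere (0:ℂ) ε, ‖f z - c * z ^ k‖ < ‖c * z ^ k‖) :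
    (f '' {z | z ∈ Metric.closedBall (0:ℂ) ε ∧ deriv f z = 0}).Finite := by
  refine Set.Finite.image _ (aux_finite_zeros hε (hf.deriv Metric.isOpen_ball) ?_)
  by_contra hcon
  push Not at hcon
  have hmem : (ε:ℂ) ∈ Metric.sphere (0:ℂ) ε := by simp [abs_of_pos hε0]
  obtain ⟨ζ, hζ⟩ : ∃ ζ : ℂ, ζ ^ k = -1 := IsAlgClosed.exists_pow_nat_eq _ hk
  have hζn : ‖ζ‖ = 1 := by
    have : ‖ζ‖ ^ k = 1 := by rw [← norm_pow, hζ]; simp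
    exact (pow_eq_one_iff_of_nonneg (norm_nonneg _) (by omega)).1 this
  have hmem2 : (ζ * ε:ℂ) ∈ Metric.sphere (0:ℂ) ε := by simp [abs_of_pos hε0, hζn]
  have hsub : Metric.sphere (0:ℂ) ε ⊆ Metric.ball 0 R' :=
    Metric.sphere_subset_closedBall.trans (Metric.closedBall_subset_ball hε)
  have heq : f (ζ * ε) = f ε :=
    Metric.isOpen_ball.is_const_of_deriv_eq_zero (convex_ball (0:ℂ) R').isPreconnected hf
      (fun z hz => hcon z hz) (hsub hmem2) (hsub hmem)
  have h1 := hcl _ hmem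
  have h2 := hcl _ hmem2
  rw [heq, mul_pow, hζ] at h2
  set p := c * (ε:ℂ) ^ k
  have e1 : c * (-1 * (ε:ℂ) ^ k) = -p := by simp [p]
  rw [e1, norm_neg] at h2
  have h3 : ‖2 * p‖ ≤ ‖f ε - -p‖ + ‖f ε - p‖ := by
    have : 2 * p = (f ε - -p) - (f ε - p) := by ring
    rw [this]; exact norm_sub_le _ _
  rw [norm_mul] at h3
  simp at h3 h2
  linarith

lemma aux_small {E G : Type*} [NormedAddCommGroup E] [NormedSpace ℂ E]
    [NormedAddCommGroup G] [NormedSpace ℂ G] {r : E → G}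
    (hr : ∀ᶠ x in 𝓝 (0:E), DifferentiableAt ℂ r x) (h0 : r 0 = 0) (hd0 : fderiv ℂ r 0 = 0)
    {ε : ℝ} (hε : 0 < ε) : ∀ᶠ x in 𝓝 (0:E), ‖fderiv ℂ r x‖ ≤ ε := by
  have h1 : HasFDerivAt r (0 : E →L[ℂ] G) 0 := hd0 ▸ hr.self_of_nhds.hasFDerivAt
  have h2 : ∀ᶠ x in 𝓝 (0:E), ‖r x‖ ≤ ε / 2 * ‖x‖ := by
    have := h1.isLittleO.def (half_pos hε)
    simpa [h0] using this
  obtain ⟨d, hd, hball⟩ := Metric.eventually_nhds_iff_ball.1 (hr.and h2)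
  filter_upwards [Metric.ball_mem_nhds (0:E) (show 0 < d / 4 by linarith)] with x hx
  rw [mem_ball_zero_iff] at hx
  refine ContinuousLinearMap.opNorm_le_bound _ hε.le fun v => ?_
  rcases eq_or_ne v 0 with rfl | hv
  · simp
  have hvn : 0 < ‖v‖ := norm_pos_iff.2 hv
  set R : ℝ := d / 4 / ‖v‖ with hR
  have hRpos : 0 < R := by positivity
  have hRv : R * ‖v‖ = d / 4 := by rw [hR]; field_simp
  have hin : ∀ z ∈ Metric.closedBall (0:ℂ) R, ‖x + z • v‖ ≤ d / 2 := fun z hz => by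
    rw [mem_closedBall_zero_iff] at hz
    have : ‖z‖ * ‖v‖ ≤ R * ‖v‖ := by gcongr
    have := norm_add_le x (z • v)
    rw [norm_smul] at this
    linarith
  have hin' : ∀ z ∈ Metric.closedBall (0:ℂ) R, x + z • v ∈ Metric.ball (0:E) d := fun z hz => by
    rw [mem_ball_zero_iff]; linarith [hin z hz]
  have hφ : ∀ z ∈ Metric.closedBall (0:ℂ) R,
      HasDerivAt (fun z : ℂ => r (x + z • v)) (fderiv ℂ r (x + z • v) v) z := fun z hz => by
    have e1 : HasDerivAt (fun z : ℂ => x + z • v) v z := by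
      simpa using ((hasDerivAt_id z).smul_const v).const_add x
    exact ((hball _ (hin' z hz)).1.hasFDerivAt).comp_hasDerivAt z e1
  have hcl : DiffContOnCl ℂ (fun z : ℂ => r (x + z • v)) (Metric.ball 0 R) := by
    apply DifferentiableOn.diffContOnCl
    rw [closure_ball _ hRpos.ne']
    exact fun z hz => (hφ z hz).differentiableAt.differentiableWithinAt
  have := Complex.norm_deriv_le_of_forall_mem_sphere_norm_le hRpos hcl (C := ε * d / 4)
    (fun z hz => by
      have hz' := Metric.sphere_subset_closedBall hz
      have a1 := (hball _ (hin' z hz')).2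
      have a2 := hin z hz'
      nlinarith)
  rw [(hφ 0 (by simpa using hRpos.le)).deriv] at this
  simp only [zero_smul, add_zero] at this
  refine this.trans (le_of_eq ?_)
  rw [div_eq_iff hRpos.ne', mul_assoc, mul_comm ‖v‖, hRv]; ring

lemma aux_ift {E : Type*} [NormedAddCommGroup E] [NormedSpace ℂ E] [CompleteSpace E]
    {r : E → E}
    (hr : ∀ᶠ x in 𝓝 (0:E), DifferentiableAt ℂ r x) (h0 : r 0 = 0) (hd0 : fderiv ℂ r 0 = 0)
    {P : E → Prop} (hP : ∀ᶠ x in 𝓝 (0:E), P x) :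
    ∃ (N T : Set E) (Ψ : E → E), N ∈ 𝓝 (0:E) ∧ T ∈ 𝓝 (0:E) ∧ (∀ x ∈ N, P x) ∧
      (∀ p ∈ T, DifferentiableAt ℂ Ψ p ∧ Ψ p ∈ N ∧ Ψ p + r (Ψ p) = p) ∧
      (∀ x ∈ N, Ψ (x + r x) = x) := by
  have hcont : ContinuousAt (fderiv ℂ r) 0 := by
    rw [Metric.continuousAt_iff']
    intro ε hε
    filter_upwards [aux_small hr h0 hd0 (half_pos hε)] with x hx
    rw [hd0, dist_zero_right]; linarith
  have hs : HasStrictFDerivAt r (fderiv ℂ r 0) 0 :=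
    hasStrictFDerivAt_of_hasFDerivAt_of_continuousAt
      (hr.mono fun x hx => hx.hasFDerivAt) hcont
  rw [hd0] at hs
  have hΦ : HasStrictFDerivAt (fun x => x + r x)
      ((ContinuousLinearEquiv.refl ℂ E : E ≃L[ℂ] E) : E →L[ℂ] E) 0 := by
    have := (hasStrictFDerivAt_id (𝕜 := ℂ) (0:E)).add hs
    rw [add_zero] at this
    exact this
  set e := hΦ.toOpenPartialHomeomorph _ with he
  have hecoe : ∀ x, e x = x + r x := fun x => rfl
  have hsrc : e.source ∈ 𝓝 (0:E) :=
    e.open_source.mem_nhds hΦ.mem_toOpenPartialHomeomorph_source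
  obtain ⟨N, hNsub, hNo, h0N⟩ := mem_nhds_iff.1
    (inter_mem hsrc (hP.and (hr.and (aux_small hr h0 hd0 (show (0:ℝ) < 1 / 2 by norm_num)))))
  have hT := e.isOpen_image_of_subset_source hNo (fun x hx => (hNsub hx).1)
  refine ⟨N, e '' N, e.symm, hNo.mem_nhds h0N, hT.mem_nhds ⟨0, h0N, by rw [hecoe, h0, add_zero]⟩,
    fun x hx => (hNsub hx).2.1, ?_, fun x hx => e.left_inv (hNsub hx).1⟩
  rintro _ ⟨x, hx, rfl⟩
  obtain ⟨hxs, -, hxd, hxn⟩ := hNsub hx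
  rw [e.left_inv hxs]
  refine ⟨?_, hx, rfl⟩
  have hlt : ‖-fderiv ℂ r x‖ < 1 := by rw [norm_neg]; exact hxn.trans_lt (by norm_num)
  set u := Units.oneSub (-fderiv ℂ r x) hlt
  have hu : HasFDerivAt e ((ContinuousLinearEquiv.unitsEquiv ℂ E u : E ≃L[ℂ] E) : E →L[ℂ] E)
      (e.symm (e x)) := by
    rw [e.left_inv hxs]
    have h1 : HasFDerivAt e (ContinuousLinearMap.id ℂ E + fderiv ℂ r x) x :=
      (hasFDerivAt_id x).add hxd.hasFDerivAt
    convert h1 using 1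
    ext y
    simp [u]
  exact (e.hasFDerivAt_symm (e.map_source hxs) hu).differentiableAt

lemma aux_L {V : Type*} (t : ℂ × V × ℂ) (a b : ℂ) (x : V)
    (h : (t.1 + I * t.2.2, t.1 - I * t.2.2, t.2.1) = (a, b, x)) :
    t = ((a + b) / 2, x, (a - b) / (2 * I)) := by
  obtain ⟨t1, t2, t3⟩ := t
  simp only [Prod.mk.injEq] at h ⊢
  obtain ⟨h1, h2, h3⟩ := h
  subst h1 h2
  refine ⟨by ring, h3, ?_⟩
  field_simp
  ring

lemma aux_L' (a b : ℂ) : (a + b) / 2 + I * ((a - b) / (2 * I)) = a ∧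
    (a + b) / 2 - I * ((a - b) / (2 * I)) = b := by
  constructor <;> field_simp <;> ring

lemma aux_gen {V : Type*} [NormedAddCommGroup V] [NormedSpace ℂ V] [CompleteSpace V]
    (ρ : ℂ × ℂ × V → ℂ)
    (r : ℂ × ℂ × V → V)
    (hρ : ∀ᶠ x in 𝓝 (0 : ℂ × ℂ × V), DifferentiableAt ℂ ρ x)
    (hr : ∀ᶠ x in 𝓝 (0 : ℂ × ℂ × V), DifferentiableAt ℂ r x)
    (hr0 : r 0 = 0) (hdr0 : fderiv ℂ r 0 = 0)
    (hrb : ∀ᶠ b in 𝓝 (0 : ℂ), r (0, b, 0) = 0)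
    (F : ℂ × V × ℂ → ℂ × V × ℂ)
    (hF : ∀ t : ℂ × V × ℂ,
      F t = (t.1 + I * t.2.2,
             t.2.1 + I • r (t.1 + I * t.2.2, t.1 - I * t.2.2, t.2.1),
             ρ (t.1 + I * t.2.2, t.1 - I * t.2.2, t.2.1)))
    (k : ℕ) (hk : 1 ≤ k) (c : ℂ) (hc : c ≠ 0)
    (horder : (fun b : ℂ => ρ (0, b, 0) - c * b ^ k) =O[𝓝 (0 : ℂ)] fun b => b ^ (k + 1)) :
    ∃ U ∈ 𝓝 (0 : ℂ × V × ℂ),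
      ∃ W ∈ 𝓝 (0 : ℂ × V × ℂ),
        ∃ D : Set (ℂ × V × ℂ),
          D ⊆ W ∧ W ⊆ closure D ∧
          ∀ q ∈ D, ∃ s : Finset (ℂ × V × ℂ),
            s.card = k ∧ ∀ t, t ∈ s ↔ (t ∈ U ∧ F t = q) := by
  classical
  set J : V →L[ℂ] ℂ × ℂ × V :=
    I • ((ContinuousLinearMap.inr ℂ ℂ (ℂ × V)).comp (ContinuousLinearMap.inr ℂ ℂ V)) with hJ
  have hJv : ∀ v, J v = (0, 0, I • v) := fun v => by simp [hJ]
  obtain ⟨N, T, Ψ, hN, hT, hNρ, hTΨ, hNΨ⟩ := aux_ift (r := fun p => J (r p))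
    (hr.mono fun x hx => J.differentiableAt.comp x hx) (by simp [hr0])
    (by
      have h1 : HasFDerivAt r (0 : ℂ × ℂ × V →L[ℂ] V) 0 := hdr0 ▸ hr.self_of_nhds.hasFDerivAt
      have h2 := J.hasFDerivAt.comp (0 : ℂ × ℂ × V) h1
      rw [ContinuousLinearMap.comp_zero] at h2
      exact h2.fderiv) hρ
  -- components of Ψ
  have hΨc : ∀ a b y, (a, b, y) ∈ T → ∃ x, Ψ (a, b, y) = (a, b, x) ∧ x + I • r (a, b, x) = y := by
    intro a b y hp
    have h := (hTΨ _ hp).2.2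
    rcases hq : Ψ (a, b, y) with ⟨a', b', x⟩
    rw [hq, hJv] at h
    simp only [Prod.mk_add_mk, add_zero, Prod.mk.injEq] at h
    obtain ⟨rfl, rfl, h3⟩ := h
    exact ⟨x, rfl, h3⟩
  have hlin : ContinuousAt (fun b : ℂ => ((0, b, 0) : ℂ × ℂ × V)) 0 := by fun_prop
  have hNb : ∀ᶠ b in 𝓝 (0:ℂ), ((0, b, 0) : ℂ × ℂ × V) ∈ N := hlin hN
  have hord : ∀ᶠ b in 𝓝 (0:ℂ), ‖ρ (0, b, 0) - c * b ^ k‖ ≤ ‖c‖ / 2 * ‖b ^ k‖ :=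
    (horder.trans_isLittleO (isLittleO_pow_pow (Nat.lt_succ_self k))).def
      (by have := norm_pos_iff.2 hc; positivity)
  obtain ⟨R1, hR1, hR1T⟩ := Metric.mem_nhds_iff.1 hT
  obtain ⟨R2, hR2, hball⟩ := Metric.eventually_nhds_iff_ball.1 (hNb.and (hrb.and hord))
  set R' := min R1 R2 with hR'
  have hR'pos : 0 < R' := lt_min hR1 hR2
  set ε := R' / 2 with hεd
  have hε0 : 0 < ε := half_pos hR'pos
  have hε : ε < R' := half_lt_self hR'pos
  have hinT : ∀ a b y, ‖a‖ < R' → ‖b‖ < R' → ‖y‖ < R' → ((a, b, y) : ℂ × ℂ × V) ∈ T := by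
    intro a b y h1 h2 h3
    apply hR1T
    rw [mem_ball_zero_iff]
    refine lt_of_lt_of_le ?_ (min_le_left R1 R2)
    simp only [Prod.norm_mk, sup_lt_iff]
    exact ⟨h1, h2, h3⟩
  have hgd : ∀ p ∈ T, DifferentiableAt ℂ (fun p => ρ (Ψ p)) p := fun p hp =>
    (hNρ _ (hTΨ p hp).2.1).comp p (hTΨ p hp).1
  -- closeness
  have hclose : ∀ᶠ q in 𝓝 (0 : ℂ × V × ℂ), ∀ b ∈ Metric.sphere (0:ℂ) ε,
      ‖(ρ (Ψ (q.1, b, q.2.1)) - q.2.2) - c * b ^ k‖ < ‖c * b ^ k‖ := by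
    apply (isCompact_sphere (0:ℂ) ε).eventually_forall_of_forall_eventually
      (P := fun (q : ℂ × V × ℂ) b =>
        ‖(ρ (Ψ (q.1, b, q.2.1)) - q.2.2) - c * b ^ k‖ < ‖c * b ^ k‖)
    intro b hb
    have hbn : ‖b‖ = ε := by simpa using hb
    have hb0 : b ≠ 0 := by rintro rfl; simp at hbn; linarith
    have hbT : ((0, b, 0) : ℂ × ℂ × V) ∈ T :=
      hinT 0 b 0 (by simpa using hR'pos) (by linarith) (by simpa using hR'pos)
    obtain ⟨b1, b2, b3⟩ := hball b (by
      rw [mem_ball_zero_iff, hbn]; exact hε.trans_le (min_le_right _ _))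
    have hΨb : Ψ (0, b, 0) = (0, b, 0) := by
      have := hNΨ _ b1
      simpa [b2] using this
    have hc1 : ContinuousAt (fun z : (ℂ × V × ℂ) × ℂ => ρ (Ψ (z.1.1, z.2, z.1.2.1)))
        ((0 : ℂ × V × ℂ), b) :=
      ContinuousAt.comp (g := fun p => ρ (Ψ p))
        (f := fun z : (ℂ × V × ℂ) × ℂ => (z.1.1, z.2, z.1.2.1))
        (hgd _ hbT).continuousAt (by fun_prop)
    refine ContinuousAt.eventually_lt (f := fun z : (ℂ × V × ℂ) × ℂ =>
        ‖(ρ (Ψ (z.1.1, z.2, z.1.2.1)) - z.1.2.2) - c * z.2 ^ k‖)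
        (g := fun z : (ℂ × V × ℂ) × ℂ => ‖c * z.2 ^ k‖) ?_ (by fun_prop) ?_
    · exact ((hc1.sub (by fun_prop)).sub (by fun_prop)).norm
    · simp only [Prod.fst_zero, Prod.snd_zero, hΨb, sub_zero]
      refine b3.trans_lt ?_
      rw [norm_mul]
      have h1 := norm_pos_iff.2 hc
      have h2 := norm_pos_iff.2 (pow_ne_zero k hb0)
      nlinarith
  obtain ⟨δ0, hδ0, hclose⟩ := Metric.eventually_nhds_iff_ball.1 hclose
  set δ := min δ0 R' with hδ
  have hδpos : 0 < δ := lt_min hδ0 hR'pos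
  have hWmem : ∀ q : ℂ × V × ℂ, q ∈ Metric.ball 0 δ ↔ ‖q.1‖ < δ ∧ ‖q.2.1‖ < δ ∧ ‖q.2.2‖ < δ := by
    intro q
    rw [mem_ball_zero_iff, Prod.norm_def, Prod.norm_def]; simp only [sup_lt_iff]
  have hWT : ∀ q ∈ Metric.ball (0 : ℂ × V × ℂ) δ, ∀ b ∈ Metric.ball (0:ℂ) R',
      (q.1, b, q.2.1) ∈ T := by
    intro q hq b hb
    obtain ⟨h1, h2, h3⟩ := (hWmem q).1 hq
    have := min_le_right δ0 R'
    exact hinT _ _ _ (by linarith) (by simpa using hb) (by linarith)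
  have hdiff : ∀ q ∈ Metric.ball (0 : ℂ × V × ℂ) δ,
      DifferentiableOn ℂ (fun b => ρ (Ψ (q.1, b, q.2.1))) (Metric.ball 0 R') := by
    intro q hq b hb
    have : DifferentiableAt ℂ (fun b : ℂ => (q.1, b, q.2.1)) b := by fun_prop
    exact ((hgd _ (hWT q hq b hb)).comp b this).differentiableWithinAt
  have hWc : ∀ q ∈ Metric.ball (0 : ℂ × V × ℂ) δ, ∀ b ∈ Metric.sphere (0:ℂ) ε,
      ‖(ρ (Ψ (q.1, b, q.2.1)) - q.2.2) - c * b ^ k‖ < ‖c * b ^ k‖ := fun q hq =>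
    hclose q (Metric.ball_subset_ball (min_le_left _ _) hq)
  set C : ℂ → V → Set ℂ := fun a y => (fun b => ρ (Ψ (a, b, y))) ''
    {z | z ∈ Metric.closedBall (0:ℂ) ε ∧ deriv (fun b => ρ (Ψ (a, b, y))) z = 0} with hC
  have hCfin : ∀ q ∈ Metric.ball (0 : ℂ × V × ℂ) δ, (C q.1 q.2.1).Finite := by
    intro q hq
    obtain ⟨h1, h2, h3⟩ := (hWmem q).1 hq
    have hq' : (q.1, q.2.1, (0:ℂ)) ∈ Metric.ball (0 : ℂ × V × ℂ) δ :=
      (hWmem _).2 ⟨h1, h2, by simpa using hδpos⟩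
    refine aux_crit hε0 hε hk (c := c) (hdiff q hq) fun b hb => ?_
    have := hWc _ hq' b hb
    simpa using this
  have hLc : Continuous (fun t : ℂ × V × ℂ => (t.1 + I * t.2.2, t.1 - I * t.2.2, t.2.1)) := by
    fun_prop
  refine ⟨{t | (t.1 + I * t.2.2, t.1 - I * t.2.2, t.2.1) ∈ N ∧
      t.1 - I * t.2.2 ∈ Metric.ball (0:ℂ) ε}, ?_, Metric.ball 0 δ, Metric.ball_mem_nhds _ hδpos,
    {q | q ∈ Metric.ball 0 δ ∧ q.2.2 ∉ C q.1 q.2.1}, fun q hq => hq.1, ?_, ?_⟩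
  · have hL2 : Continuous (fun t : ℂ × V × ℂ => t.1 - I * t.2.2) := by fun_prop
    have e1 : ∀ᶠ t in 𝓝 (0 : ℂ × V × ℂ), (t.1 + I * t.2.2, t.1 - I * t.2.2, t.2.1) ∈ N :=
      hLc.continuousAt.eventually_mem (by simp; exact hN)
    have e2 : ∀ᶠ t in 𝓝 (0 : ℂ × V × ℂ), t.1 - I * t.2.2 ∈ Metric.ball (0:ℂ) ε :=
      hL2.continuousAt.eventually_mem (by simpa using Metric.ball_mem_nhds (0:ℂ) hε0)
    exact e1.and e2
  · intro q hq
    have hdense : Dense (C q.1 q.2.1)ᶜ := by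
      rw [Set.compl_eq_univ_sdiff]; exact dense_univ.sdiff_finite (hCfin q hq)
    have hfr := mem_closure_iff_frequently.1 (hdense q.2.2)
    have hcts : ContinuousAt (fun w : ℂ => (q.1, q.2.1, w)) q.2.2 := by fun_prop
    have hev : ∀ᶠ w in 𝓝 q.2.2, (q.1, q.2.1, w) ∈ Metric.ball (0 : ℂ × V × ℂ) δ :=
      hcts (Metric.isOpen_ball.mem_nhds hq)
    rw [mem_closure_iff_frequently]
    refine hcts.tendsto.frequently ((hfr.and_eventually hev).mono fun w hw => ⟨hw.2, hw.1⟩)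
  · rintro ⟨a, y, w⟩ ⟨hq, hqC⟩
    simp only at hqC
    obtain ⟨s0, hcard, hs0⟩ := aux_main1 hε0 hε hc ((hdiff _ hq).sub_const w) (hWc _ hq)
      (fun z hz hz0 hd => hqC ⟨z, ⟨hz, by rwa [deriv_sub_const] at hd⟩, sub_eq_zero.1 hz0⟩)
    simp only at hs0
    have hεR : ∀ b ∈ Metric.ball (0:ℂ) ε, (a, b, y) ∈ T := fun b hb =>
      hWT _ hq b (Metric.ball_subset_ball hε.le hb)
    set Λ : ℂ × ℂ × V → ℂ × V × ℂ := fun p => ((p.1 + p.2.1) / 2, p.2.2, (p.1 - p.2.1) / (2 * I))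
      with hΛ
    refine ⟨s0.image (fun b => Λ (Ψ (a, b, y))), ?_, ?_⟩
    · rw [Finset.card_image_of_injOn, hcard]
      intro b hb b' hb' hbb
      obtain ⟨x, hx, -⟩ := hΨc a b y (hεR b ((hs0 b).1 hb).1)
      obtain ⟨x', hx', -⟩ := hΨc a b' y (hεR b' ((hs0 b').1 hb').1)
      simp only [hx, hx', hΛ, Prod.mk.injEq] at hbb
      have := hbb.1
      linear_combination 2 * this
    · intro t
      simp only [Finset.mem_image, Set.mem_ofPred_eq]
      constructor
      · rintro ⟨b, hb, rfl⟩
        obtain ⟨hb1, hb2⟩ := (hs0 b).1 hb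
        have hbT := hεR b hb1
        obtain ⟨x, hx, hxy⟩ := hΨc a b y hbT
        have hxN := (hTΨ _ hbT).2.1
        obtain ⟨l1, l2⟩ := aux_L' a b
        rw [hF]
        simp only [hx, hΛ, l1, l2] at hxN hb2 ⊢
        refine ⟨⟨hxN, hb1⟩, ?_⟩
        rw [hxy, sub_eq_zero.1 hb2]
      · rintro ⟨⟨htN, htb⟩, hFt⟩
        rw [hF] at hFt
        simp only [Prod.mk.injEq] at hFt
        obtain ⟨f1, f2, f3⟩ := hFt
        have hΨt := hNΨ _ htN
        rw [hJv] at hΨt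
        simp only [Prod.mk_add_mk, add_zero] at hΨt
        rw [f2, f1] at hΨt
        rw [f1] at f3
        refine ⟨t.1 - I * t.2.2, (hs0 _).2 ⟨htb, ?_⟩, ?_⟩
        · rw [hΨt, f3, sub_self]
        · rw [hΨt]
          exact (aux_L t a _ _ (by rw [f1])).symm



/-- Proposition 3.1, multiplicity statement: if ρ(0, b, 0) = c bᵏ + O(b^{k+1}) with
c ≠ 0, then generic fibers of F near 0 consist of exactly k distinct points, i.e.,
mult₀(F) = k. -/
theorem stmt2 (n : ℕ) (hn : 2 ≤ n)
    (ρ : ℂ × ℂ × (Fin (n - 2) → ℂ) → ℂ)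
    (r : ℂ × ℂ × (Fin (n - 2) → ℂ) → (Fin (n - 2) → ℂ))
    (hρ : ∀ᶠ x in 𝓝 (0 : ℂ × ℂ × (Fin (n - 2) → ℂ)), DifferentiableAt ℂ ρ x)
    (hr : ∀ᶠ x in 𝓝 (0 : ℂ × ℂ × (Fin (n - 2) → ℂ)), DifferentiableAt ℂ r x)
    (hρ0 : ρ 0 = 0) (hdρ0 : fderiv ℂ ρ 0 = 0)
    (hr0 : r 0 = 0) (hdr0 : fderiv ℂ r 0 = 0)
    (hrb : ∀ᶠ b in 𝓝 (0 : ℂ), r (0, b, 0) = 0)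
    (F : ℂ × (Fin (n - 2) → ℂ) × ℂ → ℂ × (Fin (n - 2) → ℂ) × ℂ)
    (hF : ∀ t : ℂ × (Fin (n - 2) → ℂ) × ℂ,
      F t = (t.1 + I * t.2.2,
             t.2.1 + I • r (t.1 + I * t.2.2, t.1 - I * t.2.2, t.2.1),
             ρ (t.1 + I * t.2.2, t.1 - I * t.2.2, t.2.1)))
    (k : ℕ) (hk : 1 ≤ k) (c : ℂ) (hc : c ≠ 0)
    (horder : (fun b : ℂ => ρ (0, b, 0) - c * b ^ k) =O[𝓝 (0 : ℂ)] fun b => b ^ (k + 1)) :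
    ∃ U ∈ 𝓝 (0 : ℂ × (Fin (n - 2) → ℂ) × ℂ),
      ∃ W ∈ 𝓝 (0 : ℂ × (Fin (n - 2) → ℂ) × ℂ),
        ∃ D : Set (ℂ × (Fin (n - 2) → ℂ) × ℂ),
          D ⊆ W ∧ W ⊆ closure D ∧
          ∀ q ∈ D, ∃ s : Finset (ℂ × (Fin (n - 2) → ℂ) × ℂ),
            s.card = k ∧ ∀ t, t ∈ s ↔ (t ∈ U ∧ F t = q) := by
  exact aux_gen ρ r hρ hr hr0 hdr0 hrb F hF k hk c hc horder
end

section
/- Let ρ and ρ' be ℂ-valued functions holomorphic on a neighborhood of the origin in ℂ², each satisfying ρ(0) = 0, Dρ(0) = 0 (respectively ρ'(0) = 0, Dρ'(0) = 0). Let Φ be a holomorphic map on a neighborhood U of 0 in ℂ² with Φ(0) = 0 whose derivative at 0 is invertible (a local biholomorphism at 0), and suppose Φ(M(ρ) ∩ U) ⊆ M(ρ'). Then ρ(0, χ) = 0 for all χ in a neighborhood of 0 in ℂ if and only if ρ'(0, χ) = 0 for all χ in a neighborhood of 0 in ℂ. (Lemma 3.2 of the paper, in the biholomorphic case: the vanishing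 of ρ(0, z̄) is invariant under invertible transformations sending M into M'.) -/
open Complex Filter Topology

lemma ident (H : ℂ × ℂ → ℂ) (hH : ∀ᶠ x in 𝓝 (0 : ℂ × ℂ), DifferentiableAt ℂ H x)
    (h0 : ∀ᶠ z in 𝓝 (0 : ℂ), H (z, starRingEnd ℂ z) = 0) : ∀ᶠ x in 𝓝 (0 : ℂ × ℂ), H x = 0 := by
  let A : ℂ × ℂ → ℂ × ℂ := fun y => (y.1 + I * y.2, y.1 - I * y.2)
  have hAd : Differentiable ℂ A := by fun_prop
  have hA0 : A 0 = 0 := by simp [A]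
  have h1 : ∀ᶠ y in 𝓝 (0 : ℂ × ℂ), DifferentiableAt ℂ H (A y) := by
    apply hAd.continuous.continuousAt.eventually
    rwa [hA0]
  have h2 : ∀ᶠ y in 𝓝 (0 : ℂ × ℂ), H (y.1 + I * y.2, starRingEnd ℂ (y.1 + I * y.2)) = 0 := by
    have : ContinuousAt (fun y : ℂ × ℂ => y.1 + I * y.2) 0 := by fun_prop
    apply this.eventually (p := fun z => H (z, starRingEnd ℂ z) = 0)
    simpa using h0
  obtain ⟨r, hr, hb⟩ := Metric.eventually_nhds_iff_ball.1 (h1.and h2)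
  have hmem : ∀ s t : ℂ, ‖s‖ < r → ‖t‖ < r → (s, t) ∈ Metric.ball (0 : ℂ × ℂ) r := by
    intro s t hs ht
    rw [mem_ball_zero_iff, Prod.norm_def]
    exact max_lt hs ht
  let K : ℂ × ℂ → ℂ := fun y => H (A y)
  have hK : ∀ s t : ℂ, ‖s‖ < r → ‖t‖ < r → DifferentiableAt ℂ K (s, t) := fun s t hs ht =>
    ((hb _ (hmem s t hs ht)).1).comp _ (hAd _)
  have hKr : ∀ s t : ℝ, ‖(s:ℂ)‖ < r → ‖(t:ℂ)‖ < r → K (s, t) = 0 := by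
    intro s t hs ht
    have := (hb _ (hmem s t hs ht)).2
    simpa [K, A, sub_eq_add_neg] using this
  have oned : ∀ f : ℂ → ℂ, (∀ t, ‖t‖ < r → DifferentiableAt ℂ f t) →
      (∀ t : ℝ, ‖(t:ℂ)‖ < r → f t = 0) → ∀ t, ‖t‖ < r → f t = 0 := by
    intro f hf hz t ht
    have han : AnalyticOnNhd ℂ f (Metric.ball 0 r) := by
      apply DifferentiableOn.analyticOnNhd _ Metric.isOpen_ball
      intro x hx
      exact (hf x (by simpa using hx)).differentiableWithinAt
    have hfr : ∃ᶠ z in 𝓝[≠] (0:ℂ), f z = 0 := by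
      have hT : Tendsto (fun t : ℝ => (t : ℂ)) (𝓝[≠] 0) (𝓝[≠] 0) := by
        apply tendsto_nhdsWithin_of_tendsto_nhds_of_eventually_within
        · have : ContinuousAt (fun t : ℝ => (t : ℂ)) 0 := by fun_prop
          have h := this.tendsto
          simp only [ofReal_zero] at h
          exact h.mono_left nhdsWithin_le_nhds
        · filter_upwards [self_mem_nhdsWithin] with t ht
          simpa using ht
      apply hT.frequently
      apply Eventually.frequently
      have : ∀ᶠ t : ℝ in 𝓝 0, ‖(t:ℂ)‖ < r := by
        have : ContinuousAt (fun t : ℝ => ‖(t : ℂ)‖) 0 := by fun_prop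
        apply this.eventually (p := fun x => x < r)
        apply gt_mem_nhds; simpa using hr
      exact (this.mono fun t ht => hz t ht).filter_mono nhdsWithin_le_nhds
    exact han.eqOn_zero_of_preconnected_of_frequently_eq_zero
      (convex_ball 0 r).isPreconnected (Metric.mem_ball_self hr) hfr (by simpa using ht)
  have hK1 : ∀ s : ℝ, ‖(s:ℂ)‖ < r → ∀ t, ‖t‖ < r → K (s, t) = 0 := by
    intro s hs
    apply oned (fun t => K (s, t))
    · intro t ht
      exact (hK s t hs ht).comp t (f := fun t : ℂ => ((s:ℂ), t)) (by fun_prop)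
    · intro t ht; exact hKr s t hs ht
  have hK2 : ∀ t, ‖t‖ < r → ∀ s, ‖s‖ < r → K (s, t) = 0 := by
    intro t ht
    apply oned (fun s => K (s, t))
    · intro s hs
      exact (hK s t hs ht).comp s (f := fun s : ℂ => (s, t)) (by fun_prop)
    · intro s hs; exact hK1 s hs t ht
  let B : ℂ × ℂ → ℂ × ℂ := fun x => ((x.1 + x.2) / 2, (x.1 - x.2) / (2 * I))
  have hB : ContinuousAt B 0 := by
    have : Differentiable ℂ B := by
      have : B = fun x => ((x.1 + x.2) * (2:ℂ)⁻¹, (x.1 - x.2) * (2 * I)⁻¹) := by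
        ext x <;> simp [B, div_eq_mul_inv]
      rw [this]; fun_prop
    exact this.continuous.continuousAt
  have hBb : ∀ᶠ x in 𝓝 (0 : ℂ × ℂ), B x ∈ Metric.ball (0 : ℂ × ℂ) r := by
    apply hB.eventually
    have : B 0 = 0 := by simp [B]
    rw [this]
    exact Metric.ball_mem_nhds _ hr
  filter_upwards [hBb] with x hx
  rw [mem_ball_zero_iff, Prod.norm_def] at hx
  have h := hK2 _ ((le_max_right _ _).trans_lt hx) _ ((le_max_left _ _).trans_lt hx)
  have hAB : A (B x) = x := by
    have := I_ne_zero
    ext <;> simp only [A, B] <;> field_simp <;> ring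
  have h' : H (A (B x)) = 0 := h
  rwa [hAB] at h'

lemma conj_diff (f : ℂ × ℂ → ℂ) (x : ℂ × ℂ)
    (hf : DifferentiableAt ℂ f (starRingEnd ℂ x.2, starRingEnd ℂ x.1)) :
    DifferentiableAt ℂ (fun x : ℂ × ℂ => starRingEnd ℂ (f (starRingEnd ℂ x.2, starRingEnd ℂ x.1))) x := by
  have h1 : DifferentiableAt ℂ (fun y : ℂ × ℂ => f (y.2, y.1)) (star x) :=
    DifferentiableAt.comp (star x) (g := f) (f := fun y : ℂ × ℂ => (y.2, y.1)) hf (by fun_prop)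
  have h2 := h1.star_star
  rw [star_star] at h2
  exact h2

lemma schwarz (ρ : ℂ × ℂ → ℂ) (hρ : ∀ᶠ x in 𝓝 (0 : ℂ × ℂ), DifferentiableAt ℂ ρ x)
    (hρ0 : ρ 0 = 0) (hdρ0 : fderiv ℂ ρ 0 = 0) (hv : ∀ᶠ χ in 𝓝 (0 : ℂ), ρ (0, χ) = 0)
    (ε : ℝ) (hε : 0 < ε) : ∀ᶠ x in 𝓝 (0 : ℂ × ℂ), ‖ρ x‖ ≤ ε * ‖x.1‖ := by
  have hd : HasFDerivAt ρ (0 : ℂ × ℂ →L[ℂ] ℂ) 0 := hdρ0 ▸ hρ.self_of_nhds.hasFDerivAt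
  rw [hasFDerivAt_iff_isLittleO] at hd
  have hb := hd.bound (half_pos hε)
  have hv' : ∀ᶠ x in 𝓝 (0 : ℂ × ℂ), ρ (0, x.2) = 0 := by
    have : ContinuousAt (fun y : ℂ × ℂ => y.2) 0 := by fun_prop
    exact this.eventually (p := fun z => ρ (0, z) = 0) hv
  obtain ⟨r, hr, hB⟩ := Metric.eventually_nhds_iff_ball.1 ((hρ.and hb).and hv')
  filter_upwards [Metric.ball_mem_nhds (0 : ℂ × ℂ) hr] with x hx
  rw [mem_ball_zero_iff, Prod.norm_def, max_lt_iff] at hx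
  have hmem : ∀ a : ℂ, ‖a‖ < r → (a, x.2) ∈ Metric.ball (0 : ℂ × ℂ) r := by
    intro s hs
    rw [mem_ball_zero_iff, Prod.norm_def]
    exact max_lt hs hx.2
  have h0 : ρ (0, x.2) = 0 := (hB _ (hmem 0 (by simpa using hr))).2
  have := Complex.dist_le_div_mul_dist_of_mapsTo_ball (f := fun a => ρ (a, x.2)) (c := 0) (z := x.1)
    (R₁ := r) (R₂ := ε * r) ?_ ?_ ?_
  · simp only [h0, dist_zero_right] at this
    rwa [mul_div_cancel_right₀ _ hr.ne'] at this
  · intro a ha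
    exact (((hB _ (hmem a (by simpa using ha))).1.1).comp a (f := fun a : ℂ => (a, x.2)) (by fun_prop)).differentiableWithinAt
  · intro a ha
    have h := hmem a (by simpa using ha)
    have h1 := (hB _ h).1.2
    simp only [hρ0, sub_zero, zero_apply] at h1
    rw [mem_ball_zero_iff] at h
    have : 0 < ε * r := by positivity
    have h2 : ‖ρ (a, x.2)‖ < ε * r := by nlinarith
    simpa [h0] using h2.le
  · simpa using hx.1

theorem stmt4 (ρ ρ' : ℂ × ℂ → ℂ)
    (hρ : ∀ᶠ x in 𝓝 (0 : ℂ × ℂ), DifferentiableAt ℂ ρ x)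
    (hρ' : ∀ᶠ x in 𝓝 (0 : ℂ × ℂ), DifferentiableAt ℂ ρ' x)
    (hρ0 : ρ 0 = 0) (hdρ0 : fderiv ℂ ρ 0 = 0)
    (hρ'0 : ρ' 0 = 0) (hdρ'0 : fderiv ℂ ρ' 0 = 0)
    (Φ : ℂ × ℂ → ℂ × ℂ) (U : Set (ℂ × ℂ)) (hU : U ∈ 𝓝 (0 : ℂ × ℂ))
    (hΦ : DifferentiableOn ℂ Φ U) (hΦ0 : Φ 0 = 0)
    (Φ' : (ℂ × ℂ) ≃L[ℂ] ℂ × ℂ)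
    (hΦ' : HasFDerivAt Φ (Φ' : (ℂ × ℂ) →L[ℂ] ℂ × ℂ) 0)
    (hmap : ∀ p ∈ U, p.2 = ρ (p.1, starRingEnd ℂ p.1) →
      (Φ p).2 = ρ' ((Φ p).1, starRingEnd ℂ (Φ p).1)) :
    (∀ᶠ χ in 𝓝 (0 : ℂ), ρ (0, χ) = 0) ↔ (∀ᶠ χ in 𝓝 (0 : ℂ), ρ' (0, χ) = 0) := by
  have hΦd : ∀ᶠ x in 𝓝 (0 : ℂ × ℂ), DifferentiableAt ℂ Φ x := by
    filter_upwards [eventually_mem_nhds_iff.2 hU] with x hx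
    exact hΦ.differentiableAt hx
  have hdρ : HasFDerivAt ρ (0 : ℂ × ℂ →L[ℂ] ℂ) 0 := hdρ0 ▸ hρ.self_of_nhds.hasFDerivAt
  have hdρ' : HasFDerivAt ρ' (0 : ℂ × ℂ →L[ℂ] ℂ) 0 := hdρ'0 ▸ hρ'.self_of_nhds.hasFDerivAt
  let g : ℂ × ℂ → ℂ × ℂ := fun x => (x.1, ρ x)
  have hg0 : g 0 = 0 := by simp [g, hρ0]
  have hgd : HasFDerivAt g ((ContinuousLinearMap.fst ℂ ℂ ℂ).prod 0) 0 :=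
    hasFDerivAt_fst.prodMk hdρ
  have hgdd : ∀ᶠ x in 𝓝 (0 : ℂ × ℂ), DifferentiableAt ℂ g x := by
    filter_upwards [hρ] with x hx
    exact differentiableAt_fst.prodMk hx
  have hgc : Tendsto g (𝓝 0) (𝓝 0) := by simpa [hg0] using hgd.continuousAt.tendsto
  let R : ℂ × ℂ → ℂ × ℂ := fun x => Φ (g x)
  have hR0 : R 0 = 0 := by simp [R, hg0, hΦ0]
  have hRd : HasFDerivAt R ((Φ' : (ℂ × ℂ) →L[ℂ] ℂ × ℂ).comp
      ((ContinuousLinearMap.fst ℂ ℂ ℂ).prod 0)) 0 :=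
    HasFDerivAt.comp 0 (g := Φ) (f := g) (by rw [hg0]; exact hΦ') hgd
  have hRdd : ∀ᶠ x in 𝓝 (0 : ℂ × ℂ), DifferentiableAt ℂ R x := by
    filter_upwards [hgdd, hgc.eventually hΦd] with x hx hx'
    exact hx'.comp x hx
  let c : ℂ × ℂ → ℂ × ℂ := fun x => (starRingEnd ℂ x.2, starRingEnd ℂ x.1)
  have hc : Tendsto c (𝓝 0) (𝓝 0) := by
    have : Continuous c := by
      apply Continuous.prodMk
      · exact continuous_conj.comp continuous_snd
      · exact continuous_conj.comp continuous_fst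
    have h := this.tendsto 0
    have e : c 0 = 0 := by simp [c]
    rwa [e] at h
  let Q : ℂ × ℂ → ℂ := fun x => starRingEnd ℂ (R (c x)).1
  have hQ0 : Q 0 = 0 := by
    have : c 0 = 0 := by simp [c]
    simp [Q, this, hR0]
  have hQd : ∀ᶠ x in 𝓝 (0 : ℂ × ℂ), DifferentiableAt ℂ Q x := by
    filter_upwards [hc.eventually hRdd] with x hx
    exact conj_diff (fun y => (R y).1) x hx.fst
  let S : ℂ × ℂ → ℂ × ℂ := fun x => ((R x).1, Q x)
  have hS0 : S 0 = 0 := by simp [S, hR0, hQ0]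
  have hSd : ∀ᶠ x in 𝓝 (0 : ℂ × ℂ), DifferentiableAt ℂ S x := by
    filter_upwards [hRdd, hQd] with x hx hx'
    exact hx.fst.prodMk hx'
  have hSc : Tendsto S (𝓝 0) (𝓝 0) := by
    simpa [hS0] using hSd.self_of_nhds.continuousAt.tendsto
  -- the complexified equation
  have key : ∀ᶠ x in 𝓝 (0 : ℂ × ℂ), (R x).2 = ρ' (S x) := by
    have h := ident (fun x => (R x).2 - ρ' (S x)) ?_ ?_
    · filter_upwards [h] with x hx using sub_eq_zero.1 hx
    · filter_upwards [hRdd, hSd, hSc.eventually hρ'] with x h1 h2 h3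
      exact h1.snd.sub (h3.comp x h2)
    · have ht : Tendsto (fun z : ℂ => (z, starRingEnd ℂ z)) (𝓝 0) (𝓝 0) := by
        have : Continuous (fun z : ℂ => (z, starRingEnd ℂ z)) :=
          continuous_id.prodMk continuous_conj
        have h := this.tendsto 0
        simp only [map_zero] at h
        exact h
      filter_upwards [(hgc.comp ht).eventually_mem hU] with z hz
      have := hmap _ hz rfl
      have hcz : c (z, starRingEnd ℂ z) = (z, starRingEnd ℂ z) := by simp [c]
      simp only [S, Q, hcz]
      exact sub_eq_zero.2 this
  -- curves
  have hι : HasDerivAt (fun z : ℂ => (z, (0:ℂ))) ((1:ℂ), (0:ℂ)) 0 :=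
    (hasDerivAt_id _).prodMk (hasDerivAt_const _ _)
  have hιt : Tendsto (fun z : ℂ => (z, (0:ℂ))) (𝓝 0) (𝓝 0) := hι.continuousAt.tendsto
  have hκt : Tendsto (fun z : ℂ => ((0:ℂ), z)) (𝓝 0) (𝓝 0) := by
    have : Continuous (fun z : ℂ => ((0:ℂ), z)) := by fun_prop
    exact this.tendsto 0
  have hRι : HasDerivAt (fun z : ℂ => R (z, 0)) (Φ' (1, 0)) 0 := by
    have := HasFDerivAt.comp_hasDerivAt (0:ℂ) (l := R) (f := fun z : ℂ => (z, (0:ℂ))) hRd hι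
    simp only [ContinuousLinearMap.comp_apply, ContinuousLinearMap.prod_apply] at this
    exact this
  have hG : (Φ' (1, 0)).2 = 0 := by
    have h1 : HasDerivAt (fun z : ℂ => (R (z, 0)).2) (Φ' (1, 0)).2 0 := hRι.snd
    have h2 : HasDerivAt (fun z : ℂ => ρ' (S (z, 0))) 0 0 := by
      have hS1 := HasFDerivAt.comp_hasDerivAt (0:ℂ) (l := S) (f := fun z : ℂ => (z, (0:ℂ)))
        hSd.self_of_nhds.hasFDerivAt hι
      have := HasFDerivAt.comp_hasDerivAt (0:ℂ) (l := ρ') (f := fun z : ℂ => S (z, (0:ℂ)))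
        (l' := 0) (by
          have : S (0, 0) = 0 := hS0
          rw [this]; exact hdρ') hS1
      exact this
    exact h1.unique (h2.congr_of_eventuallyEq (hιt.eventually key))
  have hF : (Φ' (1, 0)).1 ≠ 0 := by
    intro h
    have h' : Φ' (1, 0) = 0 := Prod.ext h hG
    have := (map_eq_zero_iff Φ' Φ'.injective).1 h'
    simp at this
  have hGw : (Φ' (0, 1)).2 ≠ 0 := by
    intro h
    obtain ⟨⟨a, b⟩, hab⟩ := Φ'.surjective (0, 1)
    have e : ((a, b) : ℂ × ℂ) = a • ((1, 0) : ℂ × ℂ) + b • ((0, 1) : ℂ × ℂ) := by simp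
    rw [e, map_add, map_smul, map_smul] at hab
    have := congrArg Prod.snd hab
    simp [h, hG] at this
  constructor
  · intro hv
    have hjs : HasStrictDerivAt (fun z : ℂ => (R (z, 0)).1) (Φ' (1, 0)).1 0 := by
      have hj : HasDerivAt (fun z : ℂ => (R (z, 0)).1) (Φ' (1, 0)).1 0 := hRι.fst
      have han : AnalyticAt ℂ (fun z : ℂ => (R (z, 0)).1) 0 := by
        rw [analyticAt_iff_eventually_differentiableAt]
        filter_upwards [hιt.eventually hRdd] with z hz
        exact (hz.comp z (f := fun z : ℂ => (z, (0:ℂ))) (by fun_prop)).fst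
      have := han.hasStrictDerivAt
      rwa [hj.deriv] at this
    have hm := hjs.map_nhds_eq hF
    have hm0 : (R ((0:ℂ), (0:ℂ))).1 = 0 := by
      have : R ((0:ℂ), (0:ℂ)) = 0 := hR0
      simp [this]
    simp only [hm0] at hm
    have hcc : Tendsto (starRingEnd ℂ) (𝓝 0) (𝓝 0) := by
      simpa using continuous_conj.tendsto 0
    have h1 : ∀ᶠ y in 𝓝 (0:ℂ), ρ' (0, starRingEnd ℂ y) = 0 := by
      rw [← hm, eventually_map]
      filter_upwards [hcc.eventually hv, hcc.eventually (hκt.eventually key)] with z h2 h3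
      have hR : R (0, starRingEnd ℂ z) = 0 := by
        simp only [R, g, h2]
        exact hΦ0
      simp only [S, Q, hR, c] at h3
      simpa using h3.symm
    filter_upwards [hcc.eventually h1] with y hy
    simpa using hy
  · intro hv
    have hgp : 0 < ‖(Φ' (0, 1)).2‖ := norm_pos_iff.2 hGw
    set γ := ‖(Φ' (0, 1)).2‖
    set φ := ‖(Φ' (0, 1)).1‖
    have hφ : 0 ≤ φ := norm_nonneg _
    have hs := schwarz ρ' hρ' hρ'0 hdρ'0 hv (γ / (4 * (φ + γ))) (by positivity)
    have ho := (hasFDerivAt_iff_isLittleO.1 hΦ').bound (half_pos hgp)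
    have hr : Tendsto (fun χ : ℂ => ((0:ℂ), ρ (0, χ))) (𝓝 0) (𝓝 0) := hgc.comp hκt
    filter_upwards [hr.eventually ho, hκt.eventually key, (hSc.comp hκt).eventually hs]
      with χ h1 h2 h3
    have hR : R (0, χ) = Φ (0, ρ (0, χ)) := rfl
    simp only [Function.comp_apply] at h3
    rw [← h2] at h3
    simp only [S] at h3
    rw [hR] at h3
    set r := ρ (0, χ)
    have e : Φ' ((0, r) : ℂ × ℂ) = r • Φ' (0, 1) := by
      rw [← map_smul]; simp
    simp only [hΦ0, sub_zero, ContinuousLinearEquiv.coe_coe, e, Prod.norm_mk, norm_zero,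
      norm_nonneg, sup_of_le_right] at h1
    have ha := (norm_fst_le _).trans h1
    have hb := (norm_snd_le _).trans h1
    simp only [Prod.fst_sub, Prod.snd_sub, Prod.smul_fst, Prod.smul_snd] at ha hb
    have ha' := norm_sub_norm_le (Φ (0, r)).1 (r • (Φ' (0, 1)).1)
    have hb' := norm_sub_norm_le (r • (Φ' (0, 1)).2) (Φ (0, r)).2
    rw [norm_sub_rev] at hb'
    rw [norm_smul] at ha' hb'
    have k1 : ‖(Φ (0, r)).1‖ ≤ (φ + γ / 2) * ‖r‖ := by
      change _ - ‖r‖ * φ ≤ _ at ha'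
      linarith
    have k2 : γ / 2 * ‖r‖ ≤ ‖(Φ (0, r)).2‖ := by
      change ‖r‖ * γ - _ ≤ _ at hb'
      linarith
    have k3 : γ / (4 * (φ + γ)) * ‖(Φ (0, r)).1‖ ≤ γ / 4 * ‖r‖ := by
      calc _ ≤ γ / (4 * (φ + γ)) * ((φ + γ) * ‖r‖) := by
            gcongr
            refine k1.trans ?_
            gcongr
            linarith
        _ = _ := by field_simp
    have k4 : γ / 4 * ‖r‖ ≤ 0 := by linarith
    have : ‖r‖ ≤ 0 := by
      by_contra hcon
      push Not at hcon
      have : 0 < γ / 4 * ‖r‖ := by positivity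
      linarith
    exact norm_le_zero_iff.1 this
end

section
/- Assume in addition that ρ(z, χ) = z χ + γ (z² + χ²) + h(z, χ), where γ ∈ ℂ with γ ≠ 0 and h is holomorphic near 0 in ℂ² vanishing to order at least 3 at 0 (so M is a Bishop surface with nonzero Bishop invariant γ). Then 0 is an isolated point of F⁻¹(0), and there exist neighborhoods U and W of 0 in ℂ² and a dense subset D ⊆ W such that for every q ∈ D the set F⁻¹(q) ∩ U consists of exactly 2 distinct points; that is, F is a finite map at 0 with multiplicity mult₀(F) = 2. (Final assertion of Theorem 3.3 in the case γ ≠ 0.) -/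
open Complex Filter Topology

theorem aux_A (f : ℂ × ℂ → ℂ) (hf : ∀ᶠ x in 𝓝 (0 : ℂ × ℂ), DifferentiableAt ℂ f x) (v : ℂ × ℂ) :
    ∀ᶠ x in 𝓝 (0 : ℂ × ℂ), DifferentiableAt ℂ (fun x => fderiv ℂ f x v) x := by
  have hc : ∀ᶠ x in 𝓝 (0 : ℂ × ℂ), ‖f x‖ < ‖f 0‖ + 1 :=
    (hf.self_of_nhds.continuousAt.norm).eventually_lt continuousAt_const (by simp)
  obtain ⟨R', hR', hB⟩ := Metric.eventually_nhds_iff_ball.1 (hf.and hc)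
  obtain ⟨R, hR, rfl⟩ : ∃ R : ℝ, 0 < R ∧ R' = 3 * R := ⟨R' / 3, by positivity, by ring⟩
  obtain ⟨r, hr, hrv⟩ : ∃ r : ℝ, 0 < r ∧ r * ‖v‖ < R := by
    refine ⟨R / (‖v‖ + 1), by positivity, ?_⟩
    rw [div_mul_eq_mul_div, div_lt_iff₀ (by positivity)]
    nlinarith [norm_nonneg v]
  set C := ‖f 0‖ + 1 with hC
  have hmem : ∀ x ∈ Metric.ball (0 : ℂ × ℂ) R, ∀ l : ℂ, ‖l‖ ≤ r →
      x + l • v ∈ Metric.ball (0 : ℂ × ℂ) (2 * R) := by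
    intro x hx l hl
    rw [mem_ball_zero_iff] at hx ⊢
    calc ‖x + l • v‖ ≤ ‖x‖ + ‖l‖ * ‖v‖ := (norm_add_le _ _).trans (by rw [norm_smul])
      _ ≤ ‖x‖ + r * ‖v‖ := by gcongr
      _ < 2 * R := by linarith
  have hbig : Metric.ball (0 : ℂ × ℂ) (2 * R) ⊆ Metric.ball (0 : ℂ × ℂ) (3 * R) :=
    Metric.ball_subset_ball (by linarith)
  have hbound : ∀ y ∈ Metric.ball (0 : ℂ × ℂ) (2 * R), ‖fderiv ℂ f y‖ ≤ (2 * C) / R := by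
    intro y hy
    have hsub : Metric.ball y R ⊆ Metric.ball 0 (3 * R) := by
      apply Metric.ball_subset_ball'
      rw [Metric.mem_ball] at hy; linarith
    apply norm_fderiv_le_div_of_mapsTo_ball _ _ hR
    · intro z hz
      exact (hB z (hsub hz)).1.differentiableWithinAt
    · intro z hz
      rw [Metric.mem_closedBall, dist_eq_norm]
      have h1 := (hB z (hsub hz)).2
      have h2 := (hB y (hbig hy)).2
      have := norm_sub_le (f z) (f y)
      linarith
  have key : ∀ x ∈ Metric.ball (0 : ℂ × ℂ) R, fderiv ℂ f x v =
      (2 * Real.pi * I : ℂ)⁻¹ • ∮ l in C(0, r), ((l - 0) ^ 2)⁻¹ • f (x + l • v) := by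
    intro x hx
    have hd : ∀ l : ℂ, ‖l‖ ≤ r → DifferentiableAt ℂ (fun l : ℂ => f (x + l • v)) l := by
      intro l hl
      have h1 := (hB _ (hbig (hmem x hx l hl))).1
      exact h1.comp l (by fun_prop)
    have h0 := (DifferentiableOn.deriv_eq_smul_circleIntegral (f := fun l : ℂ => f (x + l • v))
      (c := 0) hr (fun l hl => (hd l (by simpa using hl)).differentiableWithinAt))
    have h2 : deriv (fun l : ℂ => f (x + l • v)) 0 = fderiv ℂ f x v := by
      have h3 : HasFDerivAt f (fderiv ℂ f x) (x + (0 : ℂ) • v) := by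
        have := (hB _ (hbig (hmem x hx 0 (by simpa using hr.le)))).1.hasFDerivAt
        simpa using this
      have h4 : HasDerivAt (fun l : ℂ => x + l • v) v 0 := by
        simpa using ((hasDerivAt_id (0 : ℂ)).smul_const v).const_add x
      exact (h3.comp_hasDerivAt (0 : ℂ) h4).deriv
    rw [← h2]
    simp only [one_div] at h0
    rw [h0, smul_smul, inv_mul_cancel₀ (by simp [Real.pi_ne_zero]), one_smul]
  filter_upwards [Metric.ball_mem_nhds (0 : ℂ × ℂ) hR] with x₀ hx₀
  have hev : (fun x => fderiv ℂ f x v) =ᶠ[𝓝 x₀] fun x =>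
      (2 * Real.pi * I : ℂ)⁻¹ • ∮ l in C(0, r), ((l - 0) ^ 2)⁻¹ • f (x + l • v) := by
    filter_upwards [Metric.isOpen_ball.mem_nhds hx₀] with x hx using key x hx
  refine DifferentiableAt.congr_of_eventuallyEq ?_ hev
  suffices hs : DifferentiableAt ℂ (fun x : ℂ × ℂ =>
      ∮ l in C(0, r), ((l - 0) ^ 2)⁻¹ • f (x + l • v)) x₀ from
    hs.fun_const_smul _
  unfold circleIntegral
  have hn : ∀ θ : ℝ, ‖circleMap 0 r θ‖ = r := by intro θ; simp [abs_of_pos hr]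
  have hcm : ∀ θ : ℝ, circleMap 0 r θ ≠ 0 := fun θ h => by have := hn θ; simp [h] at this; linarith
  have hcont : ∀ x ∈ Metric.ball (0 : ℂ × ℂ) R, Continuous (fun θ : ℝ =>
      deriv (circleMap 0 r) θ • ((circleMap 0 r θ - 0) ^ 2)⁻¹ • f (x + circleMap 0 r θ • v)) := by
    intro x hx
    have h1 : Continuous (fun θ : ℝ => f (x + circleMap 0 r θ • v)) := by
      rw [continuous_iff_continuousAt]
      intro θ
      have h2 := (hB _ (hbig (hmem x hx _ (hn θ).le))).1.continuousAt
      have h3 : ContinuousAt (fun θ : ℝ => x + circleMap 0 r θ • v) θ := by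
        have := (continuous_circleMap 0 r).continuousAt (x := θ)
        fun_prop
      exact ContinuousAt.comp (g := f) (f := fun θ : ℝ => x + circleMap 0 r θ • v) h2 h3
    simp only [deriv_circleMap, sub_zero]
    have h4 := continuous_circleMap 0 r
    have h5 : Continuous fun θ : ℝ => (circleMap 0 r θ ^ 2)⁻¹ :=
      (h4.pow 2).inv₀ fun θ => pow_ne_zero _ (hcm θ)
    exact (h4.mul continuous_const).smul (h5.smul h1)
  have hm := intervalIntegral.hasFDerivAt_integral_of_dominated_of_fderiv_le (𝕜 := ℂ)
    (μ := MeasureTheory.volume) (a := 0) (b := 2 * Real.pi)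
    (F := fun (x : ℂ × ℂ) (θ : ℝ) =>
      deriv (circleMap 0 r) θ • ((circleMap 0 r θ - 0) ^ 2)⁻¹ • f (x + circleMap 0 r θ • v))
    (F' := fun (x : ℂ × ℂ) (θ : ℝ) =>
      deriv (circleMap 0 r) θ • ((circleMap 0 r θ - 0) ^ 2)⁻¹ •
        fderiv ℂ f (x + circleMap 0 r θ • v))
    (x₀ := x₀) (s := Metric.ball 0 R) (bound := fun _ => r * ((r ^ 2)⁻¹ * (2 * C / R)))
    (Metric.isOpen_ball.mem_nhds hx₀) ?_ ?_ ?_ ?_ ?_ ?_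
  · exact hm.differentiableAt
  · filter_upwards [Metric.isOpen_ball.mem_nhds hx₀] with x hx
    exact (hcont x hx).aestronglyMeasurable
  · exact (hcont x₀ hx₀).intervalIntegrable _ _
  · have h1 : Measurable fun θ : ℝ => fderiv ℂ f (x₀ + circleMap 0 r θ • v) := by
      apply (measurable_fderiv ℂ f).comp
      have := continuous_circleMap 0 r
      exact (by fun_prop : Continuous fun θ : ℝ => x₀ + circleMap 0 r θ • v).measurable
    have h2 : Measurable fun θ : ℝ => ((circleMap 0 r θ - 0) ^ 2)⁻¹ := by
      have := measurable_circleMap 0 r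
      fun_prop
    have h3 : Measurable fun θ : ℝ => deriv (circleMap 0 r) θ := measurable_deriv _
    exact (h3.smul (h2.smul h1)).aestronglyMeasurable
  · refine Eventually.of_forall fun θ _ x hx => ?_
    rw [norm_smul, norm_smul, norm_inv, norm_pow, sub_zero, hn, deriv_circleMap, norm_mul, hn,
      norm_I, mul_one]
    have := hbound _ (hmem x hx _ (hn θ).le)
    gcongr
  · exact intervalIntegrable_const
  · refine Eventually.of_forall fun θ _ x hx => ?_
    have h2 := (hB _ (hbig (hmem x hx _ (hn θ).le))).1.hasFDerivAt
    have h3 : HasFDerivAt (fun x => f (x + circleMap 0 r θ • v))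
        (fderiv ℂ f (x + circleMap 0 r θ • v)) x :=
      h2.comp x ((hasFDerivAt_id x).add_const (circleMap 0 r θ • v))
    exact (h3.fun_const_smul (((circleMap 0 r θ - 0) ^ 2)⁻¹)).fun_const_smul
      (deriv (circleMap 0 r) θ)

theorem aux_B (n : ℕ) : ∀ (f : ℂ × ℂ → ℂ), (∀ᶠ x in 𝓝 (0 : ℂ × ℂ), DifferentiableAt ℂ f x) →
    ContDiffAt ℂ n f 0 := by
  induction n with
  | zero =>
    intro f hf
    rw [Nat.cast_zero, contDiffAt_zero]
    exact ⟨_, hf, fun x hx => (show DifferentiableAt ℂ f x from hx).continuousAt.continuousWithinAt⟩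
  | succ n ih =>
    intro f hf
    rw [Nat.cast_succ, contDiffAt_succ_iff_hasFDerivAt]
    refine ⟨fderiv ℂ f, ⟨_, hf, fun x hx => (show DifferentiableAt ℂ f x from hx).hasFDerivAt⟩, ?_⟩
    have h1 := ih _ (aux_A f hf (1, 0))
    have h2 := ih _ (aux_A f hf (0, 1))
    have : fderiv ℂ f = fun x => fderiv ℂ f x (1, 0) • ContinuousLinearMap.fst ℂ ℂ ℂ
        + fderiv ℂ f x (0, 1) • ContinuousLinearMap.snd ℂ ℂ ℂ := by
      funext x
      ext <;> simp
    rw [this]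
    exact (h1.smul contDiffAt_const).add (h2.smul contDiffAt_const)

theorem aux_C (h : ℂ × ℂ → ℂ) (hh : ∀ᶠ x in 𝓝 (0 : ℂ × ℂ), DifferentiableAt ℂ h x)
    (hh3 : ∀ j : ℕ, j ≤ 2 → iteratedFDeriv ℂ j h 0 = 0) (ε : ℝ) (hε : 0 < ε) :
    ∃ R : ℝ, 0 < R ∧ ∀ x : ℂ × ℂ, ‖x‖ ≤ R → DifferentiableAt ℂ h x ∧
      (∀ y : ℂ × ℂ, ‖y‖ ≤ R → ‖fderiv ℂ h x - fderiv ℂ h y‖ ≤ ε * ‖x - y‖) ∧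
      ‖fderiv ℂ h x‖ ≤ ε * ‖x‖ ∧ ‖h x‖ ≤ ε * ‖x‖ ^ 2 := by
  have h0 : h 0 = 0 := by
    have := congrArg (fun m => m 0) (hh3 0 (by norm_num))
    simpa using this
  have h1 : fderiv ℂ h 0 = 0 := by
    refine ContinuousLinearMap.ext fun v => ?_
    have := congrArg (fun m => m (fun _ => v)) (hh3 1 (by norm_num))
    simpa using this
  have h2 : fderiv ℂ (fderiv ℂ h) 0 = 0 := by
    refine ContinuousLinearMap.ext fun v => ContinuousLinearMap.ext fun w => ?_
    have := congrArg (fun m => m ![v, w]) (hh3 2 (by norm_num))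
    rw [iteratedFDeriv_two_apply] at this
    simpa using this
  have hc : ContDiffAt ℂ 1 (fderiv ℂ h) 0 :=
    (aux_B 2 h hh).fderiv_right (by norm_num)
  have hs : HasStrictFDerivAt (fderiv ℂ h) (0 : ℂ × ℂ →L[ℂ] (ℂ × ℂ →L[ℂ] ℂ)) 0 := by
    rw [← h2]
    exact hc.hasStrictFDerivAt (by norm_num)
  obtain ⟨s, hs, hL⟩ := hs.exists_lipschitzOnWith_of_nnnorm_lt ⟨ε, hε.le⟩ (by
    rw [nnnorm_zero]; exact hε)
  obtain ⟨R', hR', hB⟩ := Metric.eventually_nhds_iff_ball.1 (hh.and hs)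
  have hlt : ∀ x : ℂ × ℂ, ‖x‖ ≤ R' / 2 → x ∈ Metric.ball (0 : ℂ × ℂ) R' := by
    intro x hx
    rw [mem_ball_zero_iff]; linarith
  have hLip : ∀ x : ℂ × ℂ, ‖x‖ ≤ R' / 2 → ∀ y : ℂ × ℂ, ‖y‖ ≤ R' / 2 →
      ‖fderiv ℂ h x - fderiv ℂ h y‖ ≤ ε * ‖x - y‖ := by
    intro x hx y hy
    have := hL.dist_le_mul x (hB x (hlt x hx)).2 y (hB y (hlt y hy)).2
    rw [dist_eq_norm, dist_eq_norm] at this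
    exact this
  have hN : ∀ x : ℂ × ℂ, ‖x‖ ≤ R' / 2 → ‖fderiv ℂ h x‖ ≤ ε * ‖x‖ := by
    intro x hx
    have := hLip x hx 0 (by rw [norm_zero]; positivity)
    simpa [h1] using this
  refine ⟨R' / 2, by positivity, fun x hx => ⟨(hB x (hlt x hx)).1, hLip x hx, hN x hx, ?_⟩⟩
  have := (convex_closedBall (0 : ℂ × ℂ) ‖x‖).norm_image_sub_le_of_norm_fderiv_le (𝕜 := ℂ)
    (f := h) (C := ε * ‖x‖) (x := 0) (y := x) (fun y hy => ?_) (fun y hy => ?_)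
    (by simp) (by simp)
  · simpa [h0, pow_two, mul_assoc] using this
  · rw [mem_closedBall_zero_iff] at hy
    exact (hB y (hlt y (hy.trans hx))).1
  · rw [mem_closedBall_zero_iff] at hy
    exact (hN y (hy.trans hx)).trans (by gcongr)

theorem aux_H (k k' : ℂ → ℂ) (R ε : ℝ) (hε : 0 < ε)
    (hk : ∀ x : ℂ, ‖x‖ ≤ R → HasDerivAt k (k' x) x)
    (hL : ∀ x : ℂ, ‖x‖ ≤ R → ∀ y : ℂ, ‖y‖ ≤ R → ‖k' x - k' y‖ ≤ ε * ‖x - y‖)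
    (hN : ∀ x : ℂ, ‖x‖ ≤ R → ‖k' x‖ ≤ ε * R) (a : ℂ) (ha : ‖a‖ ≤ R) :
    ∃ H : ℂ → ℂ, H a = k' a ∧ ∀ b : ℂ, ‖b‖ ≤ R → k b - k a = (b - a) * H b ∧ ‖H b‖ ≤ ε * R ∧
      ∀ c : ℂ, ‖c‖ ≤ R → ‖H b - H c‖ ≤ ε * ‖b - c‖ := by
  have hcont : ContinuousOn k' (Metric.closedBall 0 R) := by
    have : LipschitzOnWith ⟨ε, hε.le⟩ k' (Metric.closedBall 0 R) := by
      apply LipschitzOnWith.of_dist_le_mul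
      intro x hx y hy
      rw [dist_eq_norm, dist_eq_norm]
      exact hL x (by simpa using hx) y (by simpa using hy)
    exact this.continuousOn
  have hseg : ∀ b : ℂ, ‖b‖ ≤ R → ∀ t ∈ Set.Icc (0 : ℝ) 1, ‖a + t • (b - a)‖ ≤ R := by
    intro b hb t ht
    have := (convex_closedBall (0 : ℂ) R).add_smul_sub_mem (x := a) (y := b)
      (by simpa using ha) (by simpa using hb) ht
    simpa using this
  have hci : ∀ b : ℂ, ‖b‖ ≤ R → ContinuousOn (fun t : ℝ => k' (a + t • (b - a))) (Set.Icc 0 1) := by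
    intro b hb
    apply hcont.comp (by fun_prop)
    intro t ht
    simpa using hseg b hb t ht
  have hsub : Set.uIoc (0 : ℝ) 1 ⊆ Set.Icc 0 1 := by
    rw [Set.uIoc_of_le zero_le_one]; exact Set.Ioc_subset_Icc_self
  refine ⟨fun b => ∫ t in (0 : ℝ)..1, k' (a + t • (b - a)), by simp, fun b hb => ⟨?_, ?_, ?_⟩⟩
  · have := intervalIntegral.integral_unitInterval_deriv_eq_sub (hci b hb)
      (fun t ht => hk _ (hseg b hb t ht))
    simpa using this.symm
  · have := intervalIntegral.norm_integral_le_of_norm_le_const (a := 0) (b := 1) (C := ε * R)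
      (f := fun t : ℝ => k' (a + t • (b - a))) (fun t ht => hN _ (hseg b hb t (hsub ht)))
    simpa using this
  · intro c hc
    rw [← intervalIntegral.integral_sub]
    · have := intervalIntegral.norm_integral_le_of_norm_le_const (a := 0) (b := 1)
        (C := ε * ‖b - c‖)
        (f := fun t : ℝ => k' (a + t • (b - a)) - k' (a + t • (c - a))) (fun t ht => by
          refine (hL _ (hseg b hb t (hsub ht)) _ (hseg c hc t (hsub ht))).trans ?_
          gcongr
          have h1 : a + t • (b - a) - (a + t • (c - a)) = t • (b - c) := by
            simp only [real_smul]; ring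
          rw [h1, norm_smul, Real.norm_eq_abs, abs_of_nonneg (hsub ht).1]
          exact mul_le_of_le_one_left (norm_nonneg _) (hsub ht).2)
      simpa using this
    · exact (hci b hb).intervalIntegrable_of_Icc zero_le_one
    · exact (hci c hc).intervalIntegrable_of_Icc zero_le_one

theorem aux_slice (γ z w : ℂ) (hγ : γ ≠ 0) (k k' : ℂ → ℂ) (R : ℝ) (hR : 0 < R)
    (hk : ∀ x : ℂ, ‖x‖ ≤ R → HasDerivAt k (k' x) x)
    (hL : ∀ x : ℂ, ‖x‖ ≤ R → ∀ y : ℂ, ‖y‖ ≤ R → ‖k' x - k' y‖ ≤ ‖γ‖ / 16 * ‖x - y‖)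
    (hN : ∀ x : ℂ, ‖x‖ ≤ R → ‖k' x‖ ≤ ‖γ‖ / 16 * R) (hz : ‖z‖ ≤ ‖γ‖ * R / 32)
    (a : ℂ) (ha : ‖a‖ ≤ R / 4) (hroot : z * a + γ * (z ^ 2 + a ^ 2) + k a = w)
    (hcrit : z + 2 * γ * a + k' a ≠ 0) :
    ∃ b, ‖b‖ < R ∧ b ≠ a ∧ ∀ c, ‖c‖ < R →
      (z * c + γ * (z ^ 2 + c ^ 2) + k c = w ↔ c = a ∨ c = b) := by
  have hγ' : 0 < ‖γ‖ := norm_pos_iff.2 hγ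
  obtain ⟨H, hHa, hH⟩ := aux_H k k' R (‖γ‖ / 16) (by positivity) hk hL hN a (by linarith)
  let T : ℂ → ℂ := fun b => -(a + z / γ + H b / γ)
  have hT : ∀ b : ℂ, ‖b‖ ≤ R → ‖T b‖ < R := by
    intro b hb
    have h1 : ‖z / γ‖ ≤ R / 32 := by
      rw [norm_div, div_le_iff₀ hγ']; linarith
    have h2 : ‖H b / γ‖ ≤ R / 16 := by
      rw [norm_div, div_le_iff₀ hγ']; linarith [(hH b hb).2.1]
    calc ‖T b‖ = ‖a + z / γ + H b / γ‖ := norm_neg _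
      _ ≤ ‖a‖ + ‖z / γ‖ + ‖H b / γ‖ := norm_add₃_le
      _ < R := by linarith
  have hTL : ∀ b : ℂ, ‖b‖ ≤ R → ∀ c : ℂ, ‖c‖ ≤ R → ‖T b - T c‖ ≤ 1 / 16 * ‖b - c‖ := by
    intro b hb c hc
    have h1 : T b - T c = -((H b - H c) / γ) := by simp only [T]; ring
    rw [h1, norm_neg, norm_div, div_le_iff₀ hγ']
    linarith [(hH b hb).2.2 c hc]
  have hmaps : Set.MapsTo T (Metric.closedBall 0 R) (Metric.closedBall 0 R) := by
    intro b hb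
    rw [mem_closedBall_zero_iff] at hb ⊢
    exact (hT b hb).le
  have hcw : ContractingWith (1 / 16) (hmaps.restrict T _ _) := by
    refine ⟨by rw [← NNReal.coe_lt_coe]; norm_num, ?_⟩
    apply LipschitzWith.of_dist_le_mul
    rintro ⟨x, hx⟩ ⟨y, hy⟩
    have := hTL x (by simpa using hx) y (by simpa using hy)
    rw [Subtype.dist_eq, Subtype.dist_eq, dist_eq_norm, dist_eq_norm]
    simpa using this
  obtain ⟨b, hb, hfix, -⟩ := hcw.exists_fixedPoint' Metric.isClosed_closedBall.isComplete hmaps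
    (x := 0) (by simpa using hR.le) (edist_ne_top _ _)
  rw [mem_closedBall_zero_iff] at hb
  have hfix' : T b = b := hfix
  have hbR : ‖b‖ < R := by rw [← hfix']; exact hT b hb
  have hTiff : ∀ c, T c = c ↔ z + γ * (a + c) + H c = 0 := by
    intro c
    have : z + γ * (a + c) + H c = γ * (c - T c) := by
      simp only [T]; field_simp; ring
    rw [this, mul_eq_zero, sub_eq_zero]
    simp [hγ, eq_comm]
  refine ⟨b, hbR, ?_, fun c hc => ?_⟩
  · rintro rfl
    have := (hTiff b).1 hfix'
    rw [hHa] at this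
    apply hcrit
    rw [← this]; ring
  · have h1 := (hH c hc.le).1
    have h2 : z * c + γ * (z ^ 2 + c ^ 2) + k c - w = (c - a) * (z + γ * (a + c) + H c) := by
      rw [← hroot]
      linear_combination h1
    rw [← sub_eq_zero, h2, mul_eq_zero, sub_eq_zero, ← hTiff]
    refine or_congr_right ⟨fun h3 => ?_, fun h3 => h3 ▸ hfix'⟩
    have h4 := hTL c hc.le b hb
    rw [h3, hfix'] at h4
    have h5 : ‖c - b‖ = 0 := by linarith [norm_nonneg (c - b)]
    exact sub_eq_zero.1 (norm_eq_zero.1 h5)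

theorem aux_crit_s5 (γ z : ℂ) (hγ : γ ≠ 0) (k' : ℂ → ℂ) (R : ℝ)
    (hL : ∀ x : ℂ, ‖x‖ ≤ R → ∀ y : ℂ, ‖y‖ ≤ R → ‖k' x - k' y‖ ≤ ‖γ‖ / 16 * ‖x - y‖)
    (a b : ℂ) (ha : ‖a‖ ≤ R) (hb : ‖b‖ ≤ R) (h1 : z + 2 * γ * a + k' a = 0)
    (h2 : z + 2 * γ * b + k' b = 0) : a = b := by
  have hγ' : 0 < ‖γ‖ := norm_pos_iff.2 hγ
  have h3 := hL a ha b hb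
  have h4 : k' a - k' b = -(2 * γ * (a - b)) := by linear_combination h1 - h2
  rw [h4, norm_neg, norm_mul, norm_mul, RCLike.norm_ofNat] at h3
  have h5 : ‖γ‖ * ‖a - b‖ ≤ 0 := by nlinarith [mul_nonneg hγ'.le (norm_nonneg (a - b))]
  have h6 : ‖a - b‖ = 0 := by
    by_contra h
    have : 0 < ‖a - b‖ := lt_of_le_of_ne (norm_nonneg _) (Ne.symm h)
    nlinarith [mul_pos hγ' this]
  exact sub_eq_zero.1 (norm_eq_zero.1 h6)

theorem aux_root (γ z w : ℂ) (hγ : γ ≠ 0) (k k' : ℂ → ℂ) (R : ℝ) (hR : 0 < R)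
    (hk : ∀ x : ℂ, ‖x‖ ≤ R → HasDerivAt k (k' x) x)
    (hL : ∀ x : ℂ, ‖x‖ ≤ R → ∀ y : ℂ, ‖y‖ ≤ R → ‖k' x - k' y‖ ≤ ‖γ‖ / 16 * ‖x - y‖)
    (hN : ∀ x : ℂ, ‖x‖ ≤ R → ‖k' x‖ ≤ ‖γ‖ / 16 * R) (hz : ‖z‖ ≤ ‖γ‖ * R / 32)
    (hz2 : ‖z‖ ≤ R / 32) (hk0 : ‖k 0‖ ≤ ‖γ‖ / 16 * ‖z‖ ^ 2)
    (hw : ‖w‖ < ‖γ‖ * R ^ 2 / 128) :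
    ∃ a, ‖a‖ ≤ R / 4 ∧ z * a + γ * (z ^ 2 + a ^ 2) + k a = w := by
  have hγ' : 0 < ‖γ‖ := norm_pos_iff.2 hγ
  let φ : ℂ → ℂ := fun a => z * a + γ * (z ^ 2 + a ^ 2) + k a
  have hφ : ∀ x : ℂ, ‖x‖ ≤ R → HasDerivAt φ (z + 2 * γ * x + k' x) x := by
    intro x hx
    have h1 := (((hasDerivAt_id x).const_mul z).add
      ((((hasDerivAt_id x).pow 2).const_add (z ^ 2)).const_mul γ)).add (hk x hx)
    have h2 : HasDerivAt φ _ x := h1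
    refine h2.congr_deriv ?_
    simp; ring
  have hd : DifferentiableOn ℂ φ (Metric.closedBall 0 (R / 4)) := by
    intro x hx
    rw [mem_closedBall_zero_iff] at hx
    exact (hφ x (by linarith)).differentiableAt.differentiableWithinAt
  have hφ0 : φ 0 = γ * z ^ 2 + k 0 := by simp [φ]
  have hsph : ∀ x ∈ Metric.sphere (0 : ℂ) (R / 4), ‖γ‖ * R ^ 2 / 32 ≤ ‖φ x - φ 0‖ := by
    intro x hx
    rw [mem_sphere_zero_iff_norm] at hx
    obtain ⟨H, -, hH⟩ := aux_H k k' R (‖γ‖ / 16) (by positivity) hk hL hN 0 (by simpa using hR.le)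
    obtain ⟨h1, h2, -⟩ := hH x (by linarith)
    have h3 : φ x - φ 0 = γ * x ^ 2 - -(z * x + x * H x) := by
      rw [hφ0]; simp only [φ]; linear_combination h1
    have h4 := norm_sub_norm_le (γ * x ^ 2) (-(z * x + x * H x))
    have h5 := norm_add_le (z * x) (x * H x)
    rw [← h3, norm_neg, norm_mul, norm_pow, hx] at h4
    rw [norm_mul, norm_mul, hx] at h5
    nlinarith
  have hfreq : ∃ᶠ x in 𝓝 (0 : ℂ), φ x ≠ φ 0 := by
    intro hev
    have h1 : ∀ᶠ x in 𝓝 (0 : ℂ), φ x = φ 0 := by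
      filter_upwards [hev] with x hx using not_not.1 hx
    have h2 : ∀ᶠ x in 𝓝 (0 : ℂ), ‖x‖ ≤ R ∧ z + 2 * γ * x + k' x = 0 := by
      filter_upwards [h1.eventually_nhds, Metric.closedBall_mem_nhds (0 : ℂ) hR] with x hx hxR
      rw [mem_closedBall_zero_iff] at hxR
      have h3 : φ =ᶠ[𝓝 x] fun _ => φ 0 := hx
      have h4 := h3.deriv_eq
      rw [(hφ x hxR).deriv, deriv_const] at h4
      exact ⟨hxR, h4⟩
    have h3 : ∀ᶠ x in 𝓝[≠] (0 : ℂ), ‖x‖ ≤ R ∧ z + 2 * γ * x + k' x = 0 :=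
      h2.filter_mono nhdsWithin_le_nhds
    obtain ⟨x, hx, hx0⟩ := (h3.and self_mem_nhdsWithin).exists
    exact hx0 (aux_crit_s5 γ z hγ k' R hL x 0 hx.1 h2.self_of_nhds.1 hx.2 h2.self_of_nhds.2)
  have hmain := (hd.diffContOnCl_ball (subset_refl _)).ball_subset_image_closedBall
    (by positivity) hsph hfreq
  have hwm : w ∈ Metric.ball (φ 0) (‖γ‖ * R ^ 2 / 32 / 2) := by
    rw [mem_ball_iff_norm, hφ0]
    have h1 := norm_sub_le w (γ * z ^ 2 + k 0)
    have h2 := norm_add_le (γ * z ^ 2) (k 0)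
    rw [norm_mul, norm_pow] at h2
    have h3 : ‖z‖ ^ 2 ≤ (R / 32) ^ 2 := by gcongr
    have h4 : ‖γ‖ * ‖z‖ ^ 2 ≤ ‖γ‖ * (R / 32) ^ 2 := by gcongr
    have h5 : 0 < ‖γ‖ * R ^ 2 := by positivity
    nlinarith
  obtain ⟨a, ha, hae⟩ := hmain hwm
  exact ⟨a, by simpa using ha, hae⟩



/-- Theorem 3.3, final assertion for a Bishop surface with nonzero Bishop invariant
γ ≠ 0: the extended map F is finite at 0 with multiplicity mult₀(F) = 2. -/
theorem stmt5 (ρ : ℂ × ℂ → ℂ)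
    (hρ : ∀ᶠ x in 𝓝 (0 : ℂ × ℂ), DifferentiableAt ℂ ρ x)
    (hρ0 : ρ 0 = 0) (hdρ0 : fderiv ℂ ρ 0 = 0)
    (γ : ℂ) (hγ : γ ≠ 0) (h : ℂ × ℂ → ℂ)
    (hh : ∀ᶠ x in 𝓝 (0 : ℂ × ℂ), DifferentiableAt ℂ h x)
    (hh3 : ∀ j : ℕ, j ≤ 2 → iteratedFDeriv ℂ j h 0 = 0)
    (hρeq : ∀ z χ : ℂ, ρ (z, χ) = z * χ + γ * (z ^ 2 + χ ^ 2) + h (z, χ))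
    (F : ℂ × ℂ → ℂ × ℂ)
    (hF : ∀ t : ℂ × ℂ, F t = (t.1 + I * t.2, ρ (t.1 + I * t.2, t.1 - I * t.2))) :
    (∃ U ∈ 𝓝 (0 : ℂ × ℂ), ∀ t ∈ U, F t = 0 → t = 0) ∧
    (∃ U ∈ 𝓝 (0 : ℂ × ℂ), ∃ W ∈ 𝓝 (0 : ℂ × ℂ), ∃ D : Set (ℂ × ℂ),
      D ⊆ W ∧ W ⊆ closure D ∧
      ∀ q ∈ D, ∃ s : Finset (ℂ × ℂ), s.card = 2 ∧ ∀ t, t ∈ s ↔ (t ∈ U ∧ F t = q)) := by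
  have hγ' : 0 < ‖γ‖ := norm_pos_iff.2 hγ
  obtain ⟨R, hR, hRh⟩ := aux_C h hh hh3 (‖γ‖ / 16) (by positivity)
  have hinv : ∀ t : ℂ × ℂ, ∀ z χ : ℂ, (t.1 + I * t.2 = z ∧ t.1 - I * t.2 = χ) ↔
      t = ((z + χ) / 2, (z - χ) / (2 * I)) := by
    intro t z χ
    have hI := I_ne_zero
    constructor
    · rintro ⟨rfl, rfl⟩
      ext1 <;> field_simp <;> ring
    · rintro rfl
      constructor <;> field_simp <;> ring
  let U : Set (ℂ × ℂ) := {t | ‖t.1 + I * t.2‖ < R ∧ ‖t.1 - I * t.2‖ < R}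
  have hU : U ∈ 𝓝 (0 : ℂ × ℂ) := by
    apply IsOpen.mem_nhds
    · exact (isOpen_lt (f := fun t : ℂ × ℂ => ‖t.1 + I * t.2‖) (by fun_prop) continuous_const).inter
        (isOpen_lt (f := fun t : ℂ × ℂ => ‖t.1 - I * t.2‖) (by fun_prop) continuous_const)
    · simp [U, hR]
  refine ⟨⟨U, hU, ?_⟩, ?_⟩
  · rintro t ⟨-, ht2⟩ hFt
    rw [hF, Prod.mk_eq_zero] at hFt
    obtain ⟨h1, h2⟩ := hFt
    rw [h1, hρeq] at h2
    set χ := t.1 - I * t.2 with hχ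
    have h3 := (hRh (0, χ) (by simpa using ht2.le)).2.2.2
    have h4 : h (0, χ) = -(γ * χ ^ 2) := by linear_combination h2
    rw [h4, norm_neg, norm_mul, norm_pow, Prod.norm_mk, norm_zero,
      max_eq_right (norm_nonneg _)] at h3
    have h5 : χ = 0 := by
      by_contra hne
      have : 0 < ‖γ‖ * ‖χ‖ ^ 2 := mul_pos hγ' (pow_pos (norm_pos_iff.2 hne) 2)
      nlinarith
    have := (hinv t 0 0).1 ⟨h1, hχ.symm.trans h5⟩
    rw [this]; simp
  -- the slices
  have hmem : ∀ z χ : ℂ, ‖z‖ ≤ R → ‖χ‖ ≤ R → ‖((z, χ) : ℂ × ℂ)‖ ≤ R := fun z χ h1 h2 => by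
    rw [Prod.norm_mk]; exact max_le h1 h2
  have happ : ∀ L : ℂ × ℂ →L[ℂ] ℂ, ‖L (0, 1)‖ ≤ ‖L‖ := fun L => by
    simpa using L.le_opNorm (0, 1)
  have hk : ∀ z : ℂ, ‖z‖ ≤ R → ∀ x : ℂ, ‖x‖ ≤ R →
      HasDerivAt (fun χ => h (z, χ)) (fderiv ℂ h (z, x) (0, 1)) x := by
    intro z hz x hx
    have h1 := (hRh (z, x) (hmem z x hz hx)).1.hasFDerivAt
    have h2 : HasDerivAt (fun χ : ℂ => (z, χ)) ((0 : ℂ), (1 : ℂ)) x :=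
      (hasDerivAt_const x z).prodMk (hasDerivAt_id x)
    exact h1.comp_hasDerivAt x h2
  have hL : ∀ z : ℂ, ‖z‖ ≤ R → ∀ x : ℂ, ‖x‖ ≤ R → ∀ y : ℂ, ‖y‖ ≤ R →
      ‖fderiv ℂ h (z, x) (0, 1) - fderiv ℂ h (z, y) (0, 1)‖ ≤ ‖γ‖ / 16 * ‖x - y‖ := by
    intro z hz x hx y hy
    have h1 := (hRh (z, x) (hmem z x hz hx)).2.1 (z, y) (hmem z y hz hy)
    have h2 := happ (fderiv ℂ h (z, x) - fderiv ℂ h (z, y))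
    have h3 : ‖((z, x) : ℂ × ℂ) - (z, y)‖ = ‖x - y‖ := by simp
    rw [h3] at h1
    exact h2.trans h1
  have hN : ∀ z : ℂ, ‖z‖ ≤ R → ∀ x : ℂ, ‖x‖ ≤ R →
      ‖fderiv ℂ h (z, x) (0, 1)‖ ≤ ‖γ‖ / 16 * R := by
    intro z hz x hx
    have h1 := (hRh (z, x) (hmem z x hz hx)).2.2.1
    refine (happ _).trans (h1.trans ?_)
    have := hmem z x hz hx
    gcongr
  let δ : ℝ := min (‖γ‖ * R / 32) (R / 32)
  have hδ : 0 < δ := lt_min (by positivity) (by positivity)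
  let η : ℝ := ‖γ‖ * R ^ 2 / 128
  have hη : 0 < η := by positivity
  let W : Set (ℂ × ℂ) := {q | ‖q.1‖ < δ ∧ ‖q.2‖ < η}
  have hW : W ∈ 𝓝 (0 : ℂ × ℂ) := by
    apply IsOpen.mem_nhds
    · exact (isOpen_lt (f := fun t : ℂ × ℂ => ‖t.1‖) (by fun_prop) continuous_const).inter
        (isOpen_lt (f := fun t : ℂ × ℂ => ‖t.2‖) (by fun_prop) continuous_const)
    · simp [W, hδ, hη]
  have hzs : ∀ z : ℂ, ‖z‖ < δ → ‖z‖ ≤ ‖γ‖ * R / 32 ∧ ‖z‖ ≤ R / 32 ∧ ‖z‖ < R := by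
    intro z hz
    have h1 : ‖z‖ ≤ R / 32 := hz.le.trans (min_le_right _ _)
    exact ⟨hz.le.trans (min_le_left _ _), h1, by linarith⟩
  let V : ℂ → Set ℂ := fun z => {w | ∃ a : ℂ, ‖a‖ ≤ R ∧ ρ (z, a) = w ∧
    z + 2 * γ * a + fderiv ℂ h (z, a) (0, 1) = 0}
  refine ⟨U, hU, W, hW, {q | q ∈ W ∧ q.2 ∈ (V q.1)ᶜ}, fun q hq => hq.1, ?_, ?_⟩
  · rintro ⟨z, w⟩ ⟨hz, hw⟩
    have hzs' := hzs z hz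
    have hV : (V z).Subsingleton := by
      rintro _ ⟨a, ha, rfl, ha'⟩ _ ⟨b, hb, rfl, hb'⟩
      rw [aux_crit_s5 γ z hγ (fun x => fderiv ℂ h (z, x) (0, 1)) R (hL z hzs'.2.2.le) a b ha hb ha' hb']
    have hdense : Dense (V z)ᶜ := hV.finite.countable.dense_compl ℂ
    have hopen : IsOpen {w : ℂ | ‖w‖ < η} := isOpen_lt (by fun_prop) (by fun_prop)
    have hcl : w ∈ closure ({w : ℂ | ‖w‖ < η} ∩ (V z)ᶜ) :=
      hdense.open_subset_closure_inter hopen hw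
    refine map_mem_closure (f := fun w : ℂ => (z, w)) (by fun_prop) hcl ?_
    rintro w' ⟨h1, h2⟩
    exact ⟨⟨hz, h1⟩, h2⟩
  · rintro ⟨z, w⟩ ⟨⟨hz, hw⟩, hV⟩
    obtain ⟨hz1, hz2, hz3⟩ := hzs z hz
    have hk0 : ‖h (z, 0)‖ ≤ ‖γ‖ / 16 * ‖z‖ ^ 2 := by
      have := (hRh (z, 0) (hmem z 0 hz3.le (by simpa using hR.le))).2.2.2
      simpa using this
    obtain ⟨a, ha, haw⟩ := aux_root γ z w hγ (fun χ => h (z, χ))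
      (fun x => fderiv ℂ h (z, x) (0, 1)) R hR (hk z hz3.le) (hL z hz3.le) (hN z hz3.le)
      hz1 hz2 hk0 hw
    obtain ⟨b, hb, hba, hall⟩ := aux_slice γ z w hγ (fun χ => h (z, χ))
      (fun x => fderiv ℂ h (z, x) (0, 1)) R hR (hk z hz3.le) (hL z hz3.le) (hN z hz3.le)
      hz1 a ha haw (fun hc => hV ⟨a, by linarith, (hρeq z a).trans haw, hc⟩)
    let e : ℂ → ℂ × ℂ := fun χ => ((z + χ) / 2, (z - χ) / (2 * I))
    have he : e a ≠ e b := by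
      intro h1
      have h2 := ((hinv (e a) z a).2 rfl).2
      have h3 := ((hinv (e b) z b).2 rfl).2
      rw [h1] at h2
      exact hba (h3.symm.trans h2)
    refine ⟨{e a, e b}, Finset.card_pair he, fun t => ?_⟩
    rw [Finset.mem_insert, Finset.mem_singleton]
    have hab : ∀ c, c = a ∨ c = b → ‖c‖ < R := by
      rintro c (rfl | rfl)
      · linarith
      · exact hb
    constructor
    · intro ht
      obtain ⟨c, hc, rfl⟩ : ∃ c, (c = a ∨ c = b) ∧ t = e c := by
        rcases ht with rfl | rfl
        · exact ⟨a, Or.inl rfl, rfl⟩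
        · exact ⟨b, Or.inr rfl, rfl⟩
      obtain ⟨h1, h2⟩ := (hinv (e c) z c).2 rfl
      refine ⟨⟨?_, ?_⟩, ?_⟩
      · rw [h1]; exact hz3
      · rw [h2]; exact hab c hc
      · rw [hF, h1, h2, hρeq, (hall c (hab c hc)).2 hc]
    · rintro ⟨⟨-, ht2⟩, hFt⟩
      rw [hF, Prod.mk.injEq] at hFt
      obtain ⟨h1, h2⟩ := hFt
      rw [h1, hρeq] at h2
      have h3 := (hinv t z _).1 ⟨h1, rfl⟩
      rcases (hall _ ht2).1 h2 with h4 | h4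
      · left; rw [h3, h4]
      · right; rw [h3, h4]
end

section
/- Assume in addition that ρ(z, χ) = z χ + z^s + χ^s + h(z, χ), where s ≥ 3 is an integer and h is holomorphic near 0 in ℂ² vanishing to order at least s + 1 at 0 (Moser's pseudo-normal form of a Bishop surface with vanishing Bishop invariant and finite Moser invariant s). Then 0 is an isolated point of F⁻¹(0), and there exist neighborhoods U and W of 0 in ℂ² and a dense subset D ⊆ W such that for every q ∈ D the set F⁻¹(q) ∩ U consists of exactly s distinct points; that is, mult₀(F) equals the Moser invariant s. (Final assertion of Theorem 3.3 in the case γ = 0, s < ∞.) -/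
open Complex Filter Topology

lemma hol_fderiv_at {G : Type} [NormedAddCommGroup G] [NormedSpace ℂ G] [FiniteDimensional ℂ G]
    (f : ℂ × ℂ → G) (x₀ : ℂ × ℂ) (hf : ∀ᶠ x in 𝓝 x₀, DifferentiableAt ℂ f x) :
    DifferentiableAt ℂ (fderiv ℂ f) x₀ := by
  have : CompleteSpace G := FiniteDimensional.complete ℂ G
  have : ProperSpace G := FiniteDimensional.proper ℂ G
  have : ProperSpace ((ℂ × ℂ) →L[ℂ] G) := FiniteDimensional.proper ℂ _
  -- reduction to directional derivatives
  suffices H : ∀ v : ℂ × ℂ, DifferentiableAt ℂ (fun x => fderiv ℂ f x v) x₀ by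
    have e : fderiv ℂ f = fun x =>
        (ContinuousLinearMap.smulRightL ℂ (ℂ × ℂ) G (ContinuousLinearMap.fst ℂ ℂ ℂ))
          (fderiv ℂ f x (1, 0)) +
        (ContinuousLinearMap.smulRightL ℂ (ℂ × ℂ) G (ContinuousLinearMap.snd ℂ ℂ ℂ))
          (fderiv ℂ f x (0, 1)) := by
      funext x
      ext <;> simp
    rw [e]
    exact ((ContinuousLinearMap.differentiableAt _).comp x₀ (H (1, 0))).add
      ((ContinuousLinearMap.differentiableAt _).comp x₀ (H (0, 1)))
  intro v
  have hb : ∀ᶠ x in 𝓝 x₀, f x ∈ Metric.ball (f x₀) 1 :=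
    hf.self_of_nhds.continuousAt.eventually (Metric.ball_mem_nhds _ one_pos)
  obtain ⟨R, hR, hball⟩ := Metric.eventually_nhds_iff_ball.1 (hf.and hb)
  set r := R / 4 with hr
  have hr0 : 0 < r := by positivity
  have hbound : ∀ x ∈ Metric.ball x₀ (3 * r), ‖fderiv ℂ f x‖ ≤ 2 / r := by
    intro x hx
    have hsub : Metric.ball x r ⊆ Metric.ball x₀ R :=
      Metric.ball_subset_ball' (by rw [Metric.mem_ball] at hx; linarith)
    refine norm_fderiv_le_div_of_mapsTo_ball (c := x) (R₁ := r) (R₂ := 2) ?_ ?_ hr0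
    · exact fun y hy => (hball y (hsub hy)).1.differentiableWithinAt
    · intro y hy
      have h1 := (hball y (hsub hy)).2
      have h2 := (hball x (hsub (Metric.mem_ball_self hr0))).2
      rw [Metric.mem_closedBall]
      rw [Metric.mem_ball] at h1 h2
      have := dist_triangle_right (f y) (f x) (f x₀)
      linarith
  set δ := r / (‖v‖ + 1) with hδ
  have hv : 0 ≤ ‖v‖ := norm_nonneg v
  have hδ0 : 0 < δ := by positivity
  have hδv : δ * ‖v‖ ≤ r := by
    rw [hδ, div_mul_eq_mul_div, div_le_iff₀ (by positivity)]; nlinarith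
  have hmem : ∀ x ∈ Metric.ball x₀ r, ∀ ζ : ℂ, ‖ζ‖ < 2 * δ → x + ζ • v ∈ Metric.ball x₀ (3 * r) := by
    intro x hx ζ hζ
    rw [Metric.mem_ball, dist_eq_norm] at *
    have : x + ζ • v - x₀ = (x - x₀) + ζ • v := by abel
    rw [this]
    have h1 := norm_add_le (x - x₀) (ζ • v)
    have h2 : ‖ζ • v‖ = ‖ζ‖ * ‖v‖ := norm_smul _ _
    nlinarith
  have h3R : ∀ y ∈ Metric.ball x₀ (3 * r), DifferentiableAt ℂ f y := fun y hy =>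
    (hball y (Metric.ball_subset_ball (by linarith) hy)).1
  have hcauchy : ∀ x ∈ Metric.ball x₀ r, fderiv ℂ f x v =
      (2 * Real.pi * I : ℂ)⁻¹ • ∮ z in C(0, δ), ((z - 0) ^ 2)⁻¹ • f (x + z • v) := by
    intro x hx
    rw [Complex.two_pi_I_inv_smul_circleIntegral_sub_sq_inv_smul_of_differentiable
      (U := Metric.ball (0:ℂ) (2 * δ)) Metric.isOpen_ball
      (Metric.closedBall_subset_ball (by linarith)) (f := fun z : ℂ => f (x + z • v))
      _ (Metric.mem_ball_self hδ0)]
    · have h1 : HasDerivAt (fun z : ℂ => x + z • v) v 0 := by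
        simpa using ((hasDerivAt_id (0:ℂ)).smul_const v).const_add x
      have h2 : DifferentiableAt ℂ f (x + (0:ℂ) • v) :=
        h3R _ (hmem x hx 0 (by simpa using hδ0))
      have := h2.hasFDerivAt.comp_hasDerivAt (0:ℂ) h1
      have h3 := this.deriv
      simp only [zero_smul, add_zero] at h3
      exact h3.symm
    · intro z hz
      have h1 : DifferentiableAt ℂ (fun z : ℂ => x + z • v) z := by fun_prop
      exact ((h3R _ (hmem x hx z (by simpa using hz))).comp z h1).differentiableWithinAt
  have hev : (fun x => fderiv ℂ f x v) =ᶠ[𝓝 x₀] fun x =>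
      (2 * Real.pi * I : ℂ)⁻¹ • ∮ z in C(0, δ), ((z - 0) ^ 2)⁻¹ • f (x + z • v) :=
    Filter.eventually_of_mem (Metric.ball_mem_nhds x₀ hr0) hcauchy
  refine DifferentiableAt.congr_of_eventuallyEq ?_ hev
  refine DifferentiableAt.const_smul ?_ _
  have hcn : ∀ t : ℝ, ‖circleMap 0 δ t‖ = δ := fun t => by simp [abs_of_pos hδ0]
  have hcirc : ∀ x ∈ Metric.ball x₀ r, ∀ t : ℝ, x + circleMap 0 δ t • v ∈ Metric.ball x₀ (3 * r) :=
    fun x hx t => hmem x hx _ (by rw [hcn]; linarith)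
  have hcont : ∀ x ∈ Metric.ball x₀ r, Continuous (fun t : ℝ => deriv (circleMap 0 δ) t •
      ((circleMap 0 δ t - 0) ^ 2)⁻¹ • f (x + circleMap 0 δ t • v)) := by
    intro x hx
    have c1 : Continuous fun t : ℝ => circleMap 0 δ t := continuous_circleMap 0 δ
    have c2 : Continuous fun t : ℝ => f (x + circleMap 0 δ t • v) := by
      rw [continuous_iff_continuousAt]
      intro t
      have : ContinuousAt (fun t : ℝ => x + circleMap 0 δ t • v) t := by fun_prop
      exact ContinuousAt.comp (g := f) (h3R _ (hcirc x hx t)).continuousAt this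
    have c3 : Continuous fun t : ℝ => ((circleMap 0 δ t - 0) ^ 2)⁻¹ := by
      refine Continuous.inv₀ (by fun_prop) fun t => ?_
      rw [sub_zero]
      exact pow_ne_zero _ (norm_pos_iff.1 (by rw [hcn]; exact hδ0))
    simp only [deriv_circleMap]
    exact (c1.mul continuous_const).smul (c3.smul c2)
  have key := intervalIntegral.hasFDerivAt_integral_of_dominated_of_fderiv_le (𝕜 := ℂ)
    (μ := MeasureTheory.volume) (a := 0) (b := 2 * Real.pi) (s := Metric.ball x₀ r)
    (F := fun x t => deriv (circleMap 0 δ) t • ((circleMap 0 δ t - 0) ^ 2)⁻¹ • f (x + circleMap 0 δ t • v))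
    (F' := fun x t => deriv (circleMap 0 δ) t • ((circleMap 0 δ t - 0) ^ 2)⁻¹ •
      fderiv ℂ f (x + circleMap 0 δ t • v))
    (bound := fun _ => δ * ((δ ^ 2)⁻¹ * (2 / r))) (x₀ := x₀)
    (Metric.ball_mem_nhds x₀ hr0) ?_ ?_ ?_ ?_ ?_ ?_
  · exact key.differentiableAt
  · exact Filter.eventually_of_mem (Metric.ball_mem_nhds x₀ hr0) fun x hx =>
      (hcont x hx).aestronglyMeasurable
  · exact (hcont x₀ (Metric.mem_ball_self hr0)).intervalIntegrable _ _
  · refine Measurable.aestronglyMeasurable ?_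
    let : MeasurableSpace G := borel G
    have : BorelSpace G := ⟨rfl⟩
    have m1 : Measurable fun t : ℝ => circleMap 0 δ t := measurable_circleMap 0 δ
    have m0 : Measurable fun t : ℝ => x₀ + circleMap 0 δ t • v :=
      Continuous.measurable (by fun_prop)
    have m2 : Measurable fun t : ℝ => fderiv ℂ f (x₀ + circleMap 0 δ t • v) :=
      (measurable_fderiv ℂ f).comp m0
    simp only [deriv_circleMap]
    fun_prop
  · refine Filter.Eventually.of_forall fun t _ x hx => ?_
    have hb := hbound _ (hcirc x hx t)
    rw [norm_smul, norm_smul, norm_inv, norm_pow, sub_zero, hcn, deriv_circleMap, norm_mul, hcn,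
      norm_I, mul_one]
    gcongr
  · exact intervalIntegrable_const
  · refine Filter.Eventually.of_forall fun t _ x hx => ?_
    have h1 := (h3R _ (hcirc x hx t)).hasFDerivAt
    have h2 : HasFDerivAt (fun x : ℂ × ℂ => f (x + circleMap 0 δ t • v))
        (fderiv ℂ f (x + circleMap 0 δ t • v)) x := by
      have h3 := h1.comp x ((hasFDerivAt_id x).add_const (circleMap 0 δ t • v))
      rw [ContinuousLinearMap.comp_id] at h3
      exact h3
    exact (h2.const_smul _).const_smul _

lemma jet_bound (n : ℕ) : ∀ {G : Type} [NormedAddCommGroup G] [NormedSpace ℂ G]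
    [FiniteDimensional ℂ G] (f : ℂ × ℂ → G),
    (∀ᶠ x in 𝓝 (0 : ℂ × ℂ), DifferentiableAt ℂ f x) →
    (∀ j ≤ n, iteratedFDeriv ℂ j f 0 = 0) →
    ∃ C > 0, ∃ r > 0, ∀ x : ℂ × ℂ, ‖x‖ < r → ‖f x‖ ≤ C * ‖x‖ ^ (n + 1) := by
  induction n with
  | zero =>
    intro G _ _ _ f hf hj
    have h0 : f 0 = 0 := by
      have := congrArg (fun m => m 0) (hj 0 le_rfl)
      simpa using this
    obtain ⟨C, hC, hb⟩ := hf.self_of_nhds.isBigO_sub.exists_pos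
    obtain ⟨r, hr, hb⟩ := Metric.eventually_nhds_iff.1 hb.bound
    refine ⟨C, hC, r, hr, fun x hx => ?_⟩
    simpa [h0] using hb (y := x) (by simpa using hx)
  | succ n ih =>
    intro G _ _ _ f hf hj
    have h0 : f 0 = 0 := by
      have := congrArg (fun m => m 0) (hj 0 (Nat.zero_le _))
      simpa using this
    have hf' : ∀ᶠ x in 𝓝 (0 : ℂ × ℂ), DifferentiableAt ℂ (fderiv ℂ f) x :=
      hf.eventually_nhds.mono fun x hx => hol_fderiv_at f x hx
    obtain ⟨C, hC, r, hr, hb⟩ := ih (fderiv ℂ f) hf' (by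
      intro j hjn
      rw [← norm_eq_zero, norm_iteratedFDeriv_fderiv, norm_eq_zero]
      exact hj (j + 1) (by omega))
    obtain ⟨r', hr', hd⟩ := Metric.eventually_nhds_iff.1 hf
    refine ⟨C, hC, min r r', lt_min hr hr', fun x hx => ?_⟩
    have := (convex_closedBall (0 : ℂ × ℂ) ‖x‖).norm_image_sub_le_of_norm_fderiv_le (𝕜 := ℂ)
      (f := f) (C := C * ‖x‖ ^ (n + 1)) (x := 0) (y := x)
      (fun y hy => hd (by
        rw [mem_closedBall_zero_iff] at hy
        rw [dist_zero_right]; exact lt_of_le_of_lt hy (hx.trans_le (min_le_right _ _))))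
      (fun y hy => by
        rw [mem_closedBall_zero_iff] at hy
        refine (hb y (lt_of_le_of_lt hy (hx.trans_le (min_le_left _ _)))).trans ?_
        gcongr)
      (by simp) (by simp)
    rw [h0, sub_zero, sub_zero] at this
    rw [pow_succ _ (n + 1), ← mul_assoc]
    exact this


lemma circ_mul_split {R : ℝ} (hR : 0 < R) {V : Set ℂ} (hV : IsOpen V)
    (hsub : Metric.closedBall 0 R ⊆ V) {f g : ℂ → ℂ} (a : ℂ) (ha : a ∈ Metric.ball (0:ℂ) R)
    (n : ℕ) (hg : DifferentiableOn ℂ g V)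
    (hfg : ∀ z ∈ V, f z = (z - a) ^ n * g z)
    (hg0 : ∀ z ∈ Metric.sphere (0:ℂ) R, g z ≠ 0) :
    (∮ z in C(0, R), deriv f z / f z) = 2 * Real.pi * I * n + ∮ z in C(0, R), deriv g z / g z := by
  have hsV : Metric.sphere (0:ℂ) R ⊆ V := Metric.sphere_subset_closedBall.trans hsub
  have hne : ∀ z ∈ Metric.sphere (0:ℂ) R, z - a ≠ 0 := by
    intro z hz h
    rw [sub_eq_zero] at h
    subst h
    rw [mem_sphere_zero_iff_norm] at hz
    rw [mem_ball_zero_iff] at ha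
    linarith
  have e : Set.EqOn (fun z => deriv f z / f z) (fun z => n * (z - a)⁻¹ + deriv g z / g z)
      (Metric.sphere 0 R) := by
    intro z hz
    have hgz : DifferentiableAt ℂ g z := hg.differentiableAt (hV.mem_nhds (hsV hz))
    have h1 : f =ᶠ[𝓝 z] fun z => (z - a) ^ n * g z :=
      Filter.eventually_of_mem (hV.mem_nhds (hsV hz)) hfg
    have h2 : HasDerivAt (fun z => (z - a) ^ n * g z)
        (n * (z - a) ^ (n - 1) * 1 * g z + (z - a) ^ n * deriv g z) z :=
      (((hasDerivAt_id z).sub_const a).pow n).mul hgz.hasDerivAt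
    have h3 : deriv f z = _ := h1.deriv_eq.trans h2.deriv
    have h4 := hne z hz
    have h5 := hg0 z hz
    simp only [h3, hfg z (hsV hz)]
    rcases n with _ | n
    · simp
    · field_simp
      simp
      ring
  rw [circleIntegral.integral_congr hR.le e, circleIntegral.integral_add]
  · rw [circleIntegral.integral_const_mul, circleIntegral.integral_sub_inv_of_mem_ball ha]
    ring
  · refine ContinuousOn.circleIntegrable hR.le ?_
    exact continuousOn_const.mul ((continuousOn_id.sub continuousOn_const).inv₀ hne)
  · refine ContinuousOn.circleIntegrable hR.le ?_
    exact ((hg.deriv hV).continuousOn.mono hsV).div (hg.continuousOn.mono hsV) hg0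

lemma circ_zero {R : ℝ} (hR : 0 < R) {V : Set ℂ} (hV : IsOpen V)
    (hsub : Metric.closedBall 0 R ⊆ V) {g : ℂ → ℂ} (hg : DifferentiableOn ℂ g V)
    (hg0 : ∀ z ∈ Metric.closedBall (0:ℂ) R, g z ≠ 0) :
    (∮ z in C(0, R), deriv g z / g z) = 0 := by
  have hd : DifferentiableOn ℂ (fun z => deriv g z / g z) (Metric.closedBall 0 R) :=
    ((hg.deriv hV).mono hsub).div (hg.mono hsub) hg0
  exact (hd.mono (by rw [closure_ball _ hR.ne'])).diffContOnCl.circleIntegral_eq_zero hR.le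

lemma circ_count {R : ℝ} (hR : 0 < R) {V : Set ℂ} (hV : IsOpen V)
    (hsub : Metric.closedBall 0 R ⊆ V) (S : Finset ℂ) : ∀ (f : ℂ → ℂ), DifferentiableOn ℂ f V →
    (∀ z ∈ S, z ∈ Metric.ball (0:ℂ) R) →
    (∀ z ∈ Metric.closedBall (0:ℂ) R, f z = 0 ↔ z ∈ S) → (∀ z ∈ S, deriv f z ≠ 0) →
    (∮ z in C(0, R), deriv f z / f z) = 2 * Real.pi * I * S.card := by
  induction S using Finset.induction_on with
  | empty =>
    intro f hf _ h0 _
    rw [circ_zero hR hV hsub hf (fun z hz h => by simpa using (h0 z hz).1 h)]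
    simp
  | insert a S ha ih =>
    intro f hf hS h0 hd
    have haB : a ∈ Metric.ball (0:ℂ) R := hS a (Finset.mem_insert_self _ _)
    have hac := Metric.ball_subset_closedBall haB
    have haV : a ∈ V := hsub hac
    have hfa : f a = 0 := (h0 a hac).2 (Finset.mem_insert_self _ _)
    have hg : DifferentiableOn ℂ (dslope f a) V :=
      (Complex.differentiableOn_dslope (hV.mem_nhds haV)).2 hf
    have hfg : ∀ z, f z = (z - a) * dslope f a z := by
      intro z
      have := sub_smul_dslope f a z
      rw [hfa, sub_zero, smul_eq_mul] at this
      exact this.symm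
    have hga : dslope f a a ≠ 0 := by
      rw [dslope_same]; exact hd a (Finset.mem_insert_self _ _)
    have hz : ∀ z ∈ Metric.closedBall (0:ℂ) R, dslope f a z = 0 ↔ z ∈ S := by
      intro z hz
      by_cases hza : z = a
      · subst hza; exact iff_of_false hga ha
      · have := h0 z hz
        rw [hfg z, Finset.mem_insert] at this
        simpa [hza, sub_ne_zero.2 hza] using this
    rw [circ_mul_split hR hV hsub a haB 1 hg (fun z _ => by rw [pow_one]; exact hfg z),
      ih (dslope f a) hg (fun z hz => hS z (Finset.mem_insert_of_mem hz)) hz,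
      Finset.card_insert_of_notMem ha]
    · push_cast; ring
    · intro z hzS h
      refine hd z (Finset.mem_insert_of_mem hzS) ?_
      have hzB := hS z (Finset.mem_insert_of_mem hzS)
      have hzV : z ∈ V := hsub (Metric.ball_subset_closedBall hzB)
      have hgz := (hg.differentiableAt (hV.mem_nhds hzV)).hasDerivAt
      have e : f = fun z => (z - a) * dslope f a z := funext hfg
      have h2 : HasDerivAt (fun z => (z - a) * dslope f a z)
        (1 * dslope f a z + (z - a) * deriv (dslope f a) z) z :=
        ((hasDerivAt_id z).sub_const a).mul hgz
      rw [e, h2.deriv, h, (hz z (Metric.ball_subset_closedBall hzB)).2 hzS]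
      simp
    · intro z hzs h
      have := hS z (Finset.mem_insert_of_mem ((hz z (Metric.sphere_subset_closedBall hzs)).1 h))
      rw [mem_sphere_zero_iff_norm] at hzs
      rw [mem_ball_zero_iff] at this
      linarith

lemma finite_zeros {R R' : ℝ} (hRR : R < R') {f : ℂ → ℂ}
    (hf : DifferentiableOn ℂ f (Metric.ball 0 R'))
    (hne : ∃ z ∈ Metric.ball (0:ℂ) R', f z ≠ 0) :
    {z | z ∈ Metric.closedBall (0:ℂ) R ∧ f z = 0}.Finite := by
  by_contra hinf
  obtain ⟨z₀, hz₀, hacc⟩ := Set.Infinite.exists_accPt_of_subset_isCompact hinf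
    (isCompact_closedBall (0:ℂ) R) (fun z hz => hz.1)
  have han := hf.analyticOnNhd Metric.isOpen_ball
  obtain ⟨z, hz, hfz⟩ := hne
  refine hfz (han.eqOn_zero_of_preconnected_of_frequently_eq_zero
    (convex_ball _ _).isPreconnected (Metric.closedBall_subset_ball hRR hz₀) ?_ hz)
  rw [accPt_iff_frequently_nhdsNE] at hacc
  exact hacc.mono fun z hz => hz.2

lemma finite_crit {R R' : ℝ} (hRR : R < R') {f : ℂ → ℂ}
    (hf : DifferentiableOn ℂ f (Metric.ball 0 R')) :
    {w | ∃ z ∈ Metric.closedBall (0:ℂ) R, deriv f z = 0 ∧ f z = w}.Finite := by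
  by_cases hne : ∃ z ∈ Metric.ball (0:ℂ) R', deriv f z ≠ 0
  · refine ((finite_zeros hRR (hf.deriv Metric.isOpen_ball) hne).image f).subset ?_
    rintro w ⟨z, hz, h1, h2⟩
    exact ⟨z, ⟨hz, h1⟩, h2⟩
  · push Not at hne
    refine (Set.finite_singleton (f 0)).subset ?_
    rintro w ⟨z, hz, h1, rfl⟩
    have hzB := Metric.closedBall_subset_ball hRR hz
    have hR' : 0 < R' := by
      rw [mem_ball_zero_iff] at hzB; exact (norm_nonneg z).trans_lt hzB
    exact Metric.isOpen_ball.is_const_of_deriv_eq_zero (convex_ball _ _).isPreconnected hf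
      (fun x hx => hne x hx) hzB (Metric.mem_ball_self hR')

lemma circ_tendsto {R R' : ℝ} (hR : 0 < R) (hRR : R < R') {ρ : ℂ × ℂ → ℂ}
    (hρ : ∀ z χ : ℂ, ‖z‖ < R' → ‖χ‖ < R' → DifferentiableAt ℂ ρ (z, χ))
    (h0 : ∀ χ ∈ Metric.sphere (0:ℂ) R, ρ (0, χ) ≠ 0) :
    Tendsto (fun q : ℂ × ℂ => ∮ χ in C(0, R),
      deriv (fun χ => ρ (q.1, χ) - q.2) χ / (ρ (q.1, χ) - q.2)) (𝓝 0)
      (𝓝 (∮ χ in C(0, R), deriv (fun χ => ρ (0, χ)) χ / ρ (0, χ))) ∧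
    ∀ᶠ q : ℂ × ℂ in 𝓝 0, ∀ χ ∈ Metric.sphere (0:ℂ) R, ρ (q.1, χ) - q.2 ≠ 0 := by
  have hR' : 0 < R' := hR.trans hRR
  set f : ℂ × ℂ → ℂ → ℂ := fun q χ => ρ (q.1, χ) - q.2 with hf
  set B := Metric.ball (0:ℂ) R' with hB
  have hcontd : ∀ q : ℂ × ℂ, ‖q.1‖ < R' → DifferentiableOn ℂ (f q) B := by
    intro q hq χ hχ
    have h1 : DifferentiableAt ℂ (fun χ : ℂ => (q.1, χ)) χ := by fun_prop
    exact (((hρ q.1 χ hq (by simpa [hB] using hχ)).comp χ h1).sub_const _).differentiableWithinAt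
  have hq1 : ∀ᶠ q : ℂ × ℂ in 𝓝 0, ‖q.1‖ < R' := by
    have : Continuous fun q : ℂ × ℂ => ‖q.1‖ := by fun_prop
    exact this.continuousAt.eventually_lt continuousAt_const (by simpa using hR')
  have hevd : ∀ᶠ q : ℂ × ℂ in 𝓝 0, DifferentiableOn ℂ (f q) B := hq1.mono hcontd
  have hlu : TendstoLocallyUniformlyOn f (f 0) (𝓝 0) B := by
    rw [tendstoLocallyUniformlyOn_iff_forall_tendsto]
    intro χ₀ hχ₀
    have hca : ContinuousAt (fun p : (ℂ × ℂ) × ℂ => f p.1 p.2) (0, χ₀) := by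
      have h1 : ContinuousAt (fun p : (ℂ × ℂ) × ℂ => (p.1.1, p.2)) (0, χ₀) := by fun_prop
      have h2 : ContinuousAt ρ ((0:ℂ), χ₀) :=
        (hρ 0 χ₀ (by simpa using hR') (by simpa [hB] using hχ₀)).continuousAt
      have h3 : ContinuousAt (fun p : (ℂ × ℂ) × ℂ => p.1.2) (0, χ₀) := by fun_prop
      exact (ContinuousAt.comp (g := ρ) (f := fun p : (ℂ × ℂ) × ℂ => (p.1.1, p.2)) h2 h1).sub h3
    have hcb : ContinuousAt (fun p : (ℂ × ℂ) × ℂ => f 0 p.2) (0, χ₀) := by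
      have h1 : ContinuousAt (fun p : (ℂ × ℂ) × ℂ => ((0:ℂ × ℂ), p.2)) (0, χ₀) := by fun_prop
      exact ContinuousAt.comp (g := fun p : (ℂ × ℂ) × ℂ => f p.1 p.2)
        (f := fun p : (ℂ × ℂ) × ℂ => ((0:ℂ × ℂ), p.2)) hca h1
    have := (hcb.tendsto.prodMk_nhds hca.tendsto).mono_right (nhds_le_uniformity (f 0 χ₀))
    rw [nhds_prod_eq] at this
    exact this.mono_left (Filter.prod_mono le_rfl nhdsWithin_le_nhds)
  have hsB : Metric.sphere (0:ℂ) R ⊆ B :=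
    Metric.sphere_subset_closedBall.trans (Metric.closedBall_subset_ball hRR)
  have hd0 : DifferentiableOn ℂ (f 0) B := hcontd 0 (by simpa using hR')
  have hnz : ∀ χ ∈ Metric.sphere (0:ℂ) R, f 0 χ ≠ 0 := by
    intro χ hχ; simpa [hf] using h0 χ hχ
  have hcpt : IsCompact (Metric.sphere (0:ℂ) R) := isCompact_sphere _ _
  have hnev : ∀ᶠ q : ℂ × ℂ in 𝓝 0, ∀ χ ∈ Metric.sphere (0:ℂ) R, f q χ ≠ 0 := by
    have hu := (tendstoLocallyUniformlyOn_iff_tendstoUniformlyOn_of_compact hcpt).1 (hlu.mono hsB)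
    obtain ⟨m, hm, hmin⟩ : ∃ m > 0, ∀ χ ∈ Metric.sphere (0:ℂ) R, m ≤ ‖f 0 χ‖ := by
      obtain ⟨x, hx, hxm⟩ := hcpt.exists_isMinOn (NormedSpace.sphere_nonempty.2 hR.le)
        ((hd0.continuousOn.mono hsB).norm)
      exact ⟨_, norm_pos_iff.2 (hnz x hx), fun χ hχ => hxm hχ⟩
    filter_upwards [Metric.tendstoUniformlyOn_iff.1 hu m hm] with q hq χ hχ h
    have h1 := hq χ hχ
    rw [h, dist_zero_right] at h1
    exact absurd (hmin χ hχ) (not_le.2 h1)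
  refine ⟨?_, hnev⟩
  have hdiv := ((hlu.deriv hevd Metric.isOpen_ball).mono hsB).div₀ (hlu.mono hsB)
    ((hd0.deriv Metric.isOpen_ball).continuousOn.mono hsB) (hd0.continuousOn.mono hsB) hnz
  have hu := (tendstoLocallyUniformlyOn_iff_tendstoUniformlyOn_of_compact hcpt).1 hdiv
  have := hu.tendsto_circleIntegral_of_continuousOn hR.le (by
    filter_upwards [hevd, hnev] with q h1 h2
    exact ((h1.deriv Metric.isOpen_ball).continuousOn.mono hsB).div (h1.continuousOn.mono hsB) h2)
  have e : f 0 = fun χ => ρ (0, χ) := by funext χ; simp [hf]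
  rw [e] at this
  exact this



/-- Theorem 3.3, final assertion for a Bishop surface with vanishing Bishop invariant
in Moser's pseudo-normal form with finite Moser invariant s: mult₀(F) = s. -/
theorem stmt6 (ρ : ℂ × ℂ → ℂ)
    (hρ : ∀ᶠ x in 𝓝 (0 : ℂ × ℂ), DifferentiableAt ℂ ρ x)
    (hρ0 : ρ 0 = 0) (hdρ0 : fderiv ℂ ρ 0 = 0)
    (s : ℕ) (hs : 3 ≤ s) (h : ℂ × ℂ → ℂ)
    (hh : ∀ᶠ x in 𝓝 (0 : ℂ × ℂ), DifferentiableAt ℂ h x)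
    (hhs : ∀ j : ℕ, j ≤ s → iteratedFDeriv ℂ j h 0 = 0)
    (hρeq : ∀ z χ : ℂ, ρ (z, χ) = z * χ + z ^ s + χ ^ s + h (z, χ))
    (F : ℂ × ℂ → ℂ × ℂ)
    (hF : ∀ t : ℂ × ℂ, F t = (t.1 + I * t.2, ρ (t.1 + I * t.2, t.1 - I * t.2))) :
    (∃ U ∈ 𝓝 (0 : ℂ × ℂ), ∀ t ∈ U, F t = 0 → t = 0) ∧
    (∃ U ∈ 𝓝 (0 : ℂ × ℂ), ∃ W ∈ 𝓝 (0 : ℂ × ℂ), ∃ D : Set (ℂ × ℂ),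
      D ⊆ W ∧ W ⊆ closure D ∧
      ∀ q ∈ D, ∃ t' : Finset (ℂ × ℂ), t'.card = s ∧ ∀ t, t ∈ t' ↔ (t ∈ U ∧ F t = q)) := by
  have hs0 : s ≠ 0 := by omega
  obtain ⟨C, hC, r₁, hr₁, hjet⟩ := jet_bound s h hh hhs
  obtain ⟨r₂, hr₂, hρd⟩ := Metric.eventually_nhds_iff.1 hρ
  obtain ⟨r₃, hr₃, hhd⟩ := Metric.eventually_nhds_iff.1 hh
  obtain ⟨R', hR', hR₁, hR₂, hR₃, hR₄⟩ : ∃ R' > 0, R' ≤ r₁ ∧ R' ≤ r₂ ∧ R' ≤ r₃ ∧ C * R' < 1 := by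
    refine ⟨min (min r₁ r₂) (min r₃ (1 / (2 * C))), by positivity, ?_, ?_, ?_, ?_⟩
    · exact (min_le_left _ _).trans (min_le_left _ _)
    · exact (min_le_left _ _).trans (min_le_right _ _)
    · exact (min_le_right _ _).trans (min_le_left _ _)
    · have h1 : min (min r₁ r₂) (min r₃ (1 / (2 * C))) ≤ 1 / (2 * C) :=
        (min_le_right _ _).trans (min_le_right _ _)
      calc C * _ ≤ C * (1 / (2 * C)) := by gcongr
        _ < 1 := by field_simp; norm_num
  have hR₀ : 0 < R' / 2 := by positivity
  obtain ⟨R, hR, hRR⟩ : ∃ R : ℝ, 0 < R ∧ R < R' := ⟨R' / 2, hR₀, by linarith⟩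
  have hρB : ∀ z χ : ℂ, ‖z‖ < R' → ‖χ‖ < R' → DifferentiableAt ℂ ρ (z, χ) := fun z χ hz hχ =>
    hρd (by rw [dist_zero_right, Prod.norm_mk]; exact (max_lt hz hχ).trans_le hR₂)
  have hhB : ∀ χ : ℂ, ‖χ‖ < R' → DifferentiableAt ℂ h (0, χ) := fun χ hχ =>
    hhd (by rw [dist_zero_right, Prod.norm_mk, norm_zero]; exact (max_lt hR' hχ).trans_le hR₃)
  have hjB : ∀ χ : ℂ, ‖χ‖ < R' → ‖h (0, χ)‖ ≤ C * ‖χ‖ ^ (s + 1) := fun χ hχ => by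
    have := hjet (0, χ) (by rw [Prod.norm_mk, norm_zero]; exact (max_lt hR' hχ).trans_le hR₁)
    simpa using this
  have hh0 : h (0, 0) = 0 := by
    have := hjB 0 (by simpa using hR')
    simpa using this
  set u : ℂ → ℂ := fun χ => 1 + h (0, χ) / χ ^ s with hu
  have hu1 : ∀ χ : ℂ, ‖χ‖ < R' → ‖u χ - 1‖ ≤ C * ‖χ‖ := by
    intro χ hχ
    simp only [hu, add_sub_cancel_left, norm_div, norm_pow]
    by_cases h0 : χ = 0
    · subst h0; simp [hh0]
    · have hp : 0 < ‖χ‖ := norm_pos_iff.2 h0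
      rw [div_le_iff₀ (by positivity), mul_assoc, ← pow_succ']
      exact hjB χ hχ
  have hune : ∀ χ : ℂ, ‖χ‖ < R' → u χ ≠ 0 := by
    intro χ hχ h0
    have h1 := hu1 χ hχ
    rw [h0, zero_sub, norm_neg, norm_one] at h1
    have : C * ‖χ‖ ≤ C * R' := by gcongr
    linarith
  have hρ0χ : ∀ χ : ℂ, ρ (0, χ) = χ ^ s * u χ := by
    intro χ
    rw [hρeq]
    by_cases h0 : χ = 0
    · subst h0; simp [hh0, hs0]
    · simp only [hu]; field_simp; simp [hs0]
  have hud : DifferentiableOn ℂ u (Metric.ball 0 R') := by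
    refine (Complex.differentiableOn_compl_singleton_and_continuousAt_iff
      (Metric.ball_mem_nhds (0:ℂ) hR')).1 ⟨?_, ?_⟩
    · rintro χ ⟨hχ, hχ0⟩
      have h1 : DifferentiableAt ℂ (fun χ : ℂ => ((0:ℂ), χ)) χ := by fun_prop
      have h2 : DifferentiableAt ℂ (fun χ : ℂ => h (0, χ)) χ :=
        (hhB χ (by simpa using hχ)).comp χ h1
      exact ((h2.div (differentiableAt_id.pow s)
        (pow_ne_zero _ (by simpa using hχ0))).const_add 1).differentiableWithinAt
    · have hu0 : u 0 = 1 := by simp [hu, hh0]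
      rw [ContinuousAt, hu0, tendsto_iff_norm_sub_tendsto_zero]
      refine squeeze_zero' (Eventually.of_forall fun _ => norm_nonneg _)
        (Filter.eventually_of_mem (Metric.ball_mem_nhds (0:ℂ) hR') fun χ hχ =>
          hu1 χ (by simpa using hχ)) ?_
      have : Continuous fun χ : ℂ => C * ‖χ‖ := by fun_prop
      simpa using this.tendsto 0
  have hzero : ∀ χ : ℂ, ‖χ‖ < R' → ρ (0, χ) = 0 → χ = 0 := by
    intro χ hχ h0
    rw [hρ0χ, mul_eq_zero] at h0
    exact pow_eq_zero_iff hs0 |>.1 (h0.resolve_right (hune χ hχ))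
  have hsub : Metric.closedBall (0:ℂ) R ⊆ Metric.ball 0 R' := Metric.closedBall_subset_ball hRR
  have hT0 : (∮ χ in C(0, R), deriv (fun χ => ρ (0, χ)) χ / ρ (0, χ)) = 2 * Real.pi * I * s := by
    rw [circ_mul_split hR Metric.isOpen_ball hsub (f := fun χ => ρ (0, χ)) 0
      (Metric.mem_ball_self hR) s hud (fun z _ => by simpa using hρ0χ z),
      circ_zero hR Metric.isOpen_ball hsub hud, add_zero]
    · intro z hz; exact hune z (by simpa using hsub hz)
    · intro z hz; exact hune z (by simpa using hsub (Metric.sphere_subset_closedBall hz))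
  obtain ⟨hT, hnz⟩ := circ_tendsto hR hRR hρB (by
    intro χ hχ h0
    have := hzero χ (by simpa using hsub (Metric.sphere_subset_closedBall hχ)) h0
    rw [mem_sphere_zero_iff_norm, this, norm_zero] at hχ
    linarith)
  rw [hT0] at hT
  have hI : ∀ a b : ℂ, (a + b) / 2 + I * ((a - b) / (2 * I)) = a := fun a b => by
    field_simp; ring
  have hI' : ∀ a b : ℂ, (a + b) / 2 - I * ((a - b) / (2 * I)) = b := fun a b => by
    field_simp; ring
  have hII : ∀ t : ℂ × ℂ, (((t.1 + I * t.2) + (t.1 - I * t.2)) / 2,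
      ((t.1 + I * t.2) - (t.1 - I * t.2)) / (2 * I)) = t := fun t => by
    ext
    · simp
    · simp only; field_simp; ring
  have hUo : ∀ r > 0, {t : ℂ × ℂ | ‖t.1 - I * t.2‖ < r} ∈ 𝓝 (0 : ℂ × ℂ) := by
    intro r hr
    have : Continuous fun t : ℂ × ℂ => ‖t.1 - I * t.2‖ := by fun_prop
    exact this.continuousAt.eventually_lt continuousAt_const (by simpa using hr)
  refine ⟨⟨_, hUo R' hR', ?_⟩, ⟨_, hUo R hR, ?_⟩⟩
  · intro t ht h0
    rw [hF, Prod.mk_eq_zero] at h0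
    obtain ⟨h1, h2⟩ := h0
    rw [h1] at h2
    have h3 := hzero _ ht h2
    rw [← hII t, h1, h3]; simp
  have hTe := hT.eventually (Metric.ball_mem_nhds _ Real.two_pi_pos)
  have hq1 : ∀ᶠ q : ℂ × ℂ in 𝓝 0, ‖q.1‖ < R' := by
    have : Continuous fun q : ℂ × ℂ => ‖q.1‖ := by fun_prop
    exact this.continuousAt.eventually_lt continuousAt_const (by simpa using hR')
  obtain ⟨δ, hδ, hW⟩ := Metric.eventually_nhds_iff_ball.1 ((hTe.and hnz).and hq1)
  have hfd : ∀ z : ℂ, ‖z‖ < R' → DifferentiableOn ℂ (fun χ => ρ (z, χ)) (Metric.ball 0 R') := by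
    intro z hz χ hχ
    have h1 : DifferentiableAt ℂ (fun χ : ℂ => (z, χ)) χ := by fun_prop
    exact ((hρB z χ hz (by simpa using hχ)).comp χ h1).differentiableWithinAt
  refine ⟨Metric.ball 0 δ, Metric.ball_mem_nhds _ hδ,
    {q | q ∈ Metric.ball 0 δ ∧ q.2 ∉ {w | ∃ χ ∈ Metric.closedBall (0:ℂ) R,
      deriv (fun χ => ρ (q.1, χ)) χ = 0 ∧ ρ (q.1, χ) = w}}, fun q hq => hq.1, ?_, ?_⟩
  · rintro ⟨z, w⟩ hq
    have hfin := finite_crit hRR (hfd z (hW _ hq).2)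
    have hdense := hfin.countable.dense_compl ℂ
    rw [mem_closure_iff]
    intro O hO hqO
    have hc : Continuous fun w : ℂ => (z, w) := by fun_prop
    obtain ⟨w', hw', hw''⟩ := hdense.inter_open_nonempty _
      ((hO.inter Metric.isOpen_ball).preimage hc) ⟨w, hqO, hq⟩
    exact ⟨(z, w'), hw'.1, hw'.2, hw''⟩
  · rintro ⟨z, w⟩ ⟨hq, hbad⟩
    obtain ⟨⟨hTq, hnzq⟩, hz⟩ := hW _ hq
    simp only at hTq hnzq hz hbad
    have hd : DifferentiableOn ℂ (fun χ => ρ (z, χ) - w) (Metric.ball 0 R') :=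
      (hfd z hz).sub_const w
    have hderiv : ∀ χ, deriv (fun χ => ρ (z, χ) - w) χ = deriv (fun χ => ρ (z, χ)) χ :=
      fun χ => deriv_sub_const w
    have hfin : {χ | χ ∈ Metric.closedBall (0:ℂ) R ∧ ρ (z, χ) - w = 0}.Finite := by
      refine finite_zeros hRR hd ?_
      obtain ⟨χ, hχ⟩ := (NormedSpace.sphere_nonempty (E := ℂ) (x := 0)).2 hR.le
      exact ⟨χ, hsub (Metric.sphere_subset_closedBall hχ), hnzq χ hχ⟩
    have hSm : ∀ χ, χ ∈ hfin.toFinset ↔ ‖χ‖ < R ∧ ρ (z, χ) = w := by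
      intro χ
      rw [Set.Finite.mem_toFinset, Set.mem_ofPred_eq, mem_closedBall_zero_iff, sub_eq_zero]
      refine ⟨fun ⟨h1, h2⟩ => ⟨lt_of_le_of_ne h1 fun h3 => ?_, h2⟩, fun ⟨h1, h2⟩ => ⟨h1.le, h2⟩⟩
      exact hnzq χ (by simpa using h3) (sub_eq_zero.2 h2)
    have hcount := circ_count hR Metric.isOpen_ball hsub hfin.toFinset _ hd
      (fun χ hχ => by simpa using ((hSm χ).1 hχ).1)
      (fun χ hχ => by rw [Set.Finite.mem_toFinset]; exact ⟨fun h => ⟨hχ, h⟩, fun h => h.2⟩)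
      (fun χ hχ h0 => by
        rw [hderiv] at h0
        obtain ⟨h1, h2⟩ := (hSm χ).1 hχ
        exact hbad ⟨χ, by simpa using h1.le, h0, h2⟩)
    rw [hcount, dist_eq_norm, ← mul_sub, norm_mul, norm_mul, norm_mul, norm_I] at hTq
    have hcard : hfin.toFinset.card = s := by
      have h1 : ‖((hfin.toFinset.card : ℂ) - s)‖ < 1 := by
        have hpi := Real.pi_pos
        simp only [norm_ofNat, norm_real, Real.norm_eq_abs, abs_of_pos hpi, mul_one] at hTq
        by_contra hcon
        push Not at hcon
        nlinarith
      have h2 : ((hfin.toFinset.card : ℂ) - s) = (((hfin.toFinset.card : ℤ) - s : ℤ) : ℂ) := by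
        push_cast; rfl
      rw [h2, Complex.norm_intCast] at h1
      have h3 : |((hfin.toFinset.card : ℤ) - s : ℤ)| < 1 := by exact_mod_cast h1
      have := Int.abs_lt_one_iff.1 h3
      omega
    refine ⟨hfin.toFinset.image fun χ => ((z + χ) / 2, (z - χ) / (2 * I)), ?_, ?_⟩
    · rw [Finset.card_image_of_injective, hcard]
      intro a b hab
      have h1 := congrArg Prod.fst hab
      simp only at h1
      linear_combination 2 * h1
    · intro t
      rw [Finset.mem_image, hF, Set.mem_ofPred_eq, Prod.mk.injEq]
      constructor
      · rintro ⟨χ, hχ, rfl⟩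
        obtain ⟨h1, h2⟩ := (hSm χ).1 hχ
        simp only [hI, hI']
        exact ⟨h1, trivial, h2⟩
      · rintro ⟨h1, h2, h3⟩
        refine ⟨t.1 - I * t.2, (hSm _).2 ⟨h1, by rw [← h2]; exact h3⟩, ?_⟩
        rw [← h2]; exact hII t
end
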